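/- arXiv:1012.4607 — 7 statements merged into one kernel-verified Lean document; each statement's English description precedes it below -/
import Mathlib

section
/- Let V be a finite type, let q : V → V → ℕ encode a quiver with no loops and no oriented 2-cycles (q i i = 0 for all i, and min (q i j) (q j i) = 0 for all i, j), and let v be a vertex. Then Fomin–Zelevinsky mutation at v is an involution: μ_v (μ_v q) = q. -/
/-- Fomin–Zelevinsky mutation at the vertex `v` of a quiver (with no loops and no
oriented 2-cycles) encoded by its arrow-count function `q : V → V → ℕ`. -/
def fzMut {V : Type*} [DecidableEq V] (q : V → V → ℕ) (v : V) : V → V → ℕ :=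
  fun i j =>
    if i = v ∨ j = v then q j i
    else ((q i j : ℤ) - q j i + q i v * q v j - q j v * q v i).toNat

theorem fzMut_involutive {V : Type*} [Fintype V] [DecidableEq V]
    (q : V → V → ℕ)
    (hloops : ∀ i, q i i = 0)
    (htwocycles : ∀ i j, min (q i j) (q j i) = 0)
    (v : V) :
    fzMut (fzMut q v) v = q := by
  funext i j
  by_cases h : i = v ∨ j = v
  · have h' : j = v ∨ i = v := h.symm
    simp only [fzMut, if_pos h, if_pos h']
  · have h' : ¬ (j = v ∨ i = v) := fun k => h k.symm
    have hm := htwocycles i j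
    simp only [fzMut, if_neg h, if_neg h', true_or, or_true, if_true]
    have e1 : (q v i : ℤ) * q j v = q j v * q v i := mul_comm _ _
    have e2 : (q v j : ℤ) * q i v = q i v * q v j := mul_comm _ _
    rw [e1, e2]
    generalize (q j v : ℤ) * q v i = a
    generalize (q i v : ℤ) * q v j = b
    omega
end

section
/- Fix integers m ≥ 1 and n ≥ 2 and set N = m·n + 2. A set S of pairwise noncrossing m-diagonals of the N-gon is maximal under inclusion (i.e., is an (m+2)-angulation) if and only if S has exactly n − 1 elements. In particular, every set of pairwise noncrossing m-diagonals has at most n − 1 elements, and every maximal one has exactly n − 1 elements. -/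
/-- `d` is an `m`-diagonal of the `(m*n+2)`-gon, whose vertices are identified with
`ZMod (m*n+2)` in cyclic order: `d = {a, b}` where `a, b` are distinct non-adjacent
vertices with `b - a = m*i + 1` for some `1 ≤ i ≤ n - 1`. -/
def IsMDiag (m n : ℕ) (d : Finset (ZMod (m * n + 2))) : Prop :=
  ∃ a b : ZMod (m * n + 2), d = {a, b} ∧ a ≠ b ∧ b - a ≠ 1 ∧ a - b ≠ 1 ∧
    ∃ i : ℕ, 1 ≤ i ∧ i ≤ n - 1 ∧ b - a = ((m * i + 1 : ℕ) : ZMod (m * n + 2))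

/-- `x` lies strictly inside the arc of the cycle `ZMod N` going (clockwise) from `a` to `b`. -/
def InOpenArc {N : ℕ} (a b x : ZMod N) : Prop :=
  ∃ k : ℕ, 0 < k ∧ k < (b - a).val ∧ x = a + (k : ZMod N)

/-- Two diagonals `D = {a, b}` and `E = {c, d}` cross: one of `c, d` lies strictly inside
one of the two arcs determined by `a` and `b`, and the other lies strictly inside the
other arc. -/
def Crosses {N : ℕ} (D E : Finset (ZMod N)) : Prop :=
  ∃ a b c d : ZMod N, D = {a, b} ∧ E = {c, d} ∧ InOpenArc a b c ∧ InOpenArc b a d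

/-- `S` is a set of pairwise noncrossing `m`-diagonals of the `(m*n+2)`-gon. -/
def NonCrossingMDiags (m n : ℕ) (S : Finset (Finset (ZMod (m * n + 2)))) : Prop :=
  (∀ D ∈ S, IsMDiag m n D) ∧ ∀ D ∈ S, ∀ E ∈ S, D ≠ E → ¬ Crosses D E

/-- An `(m+2)`-angulation: an inclusion-maximal set of pairwise noncrossing `m`-diagonals. -/
def IsAngulation (m n : ℕ) (S : Finset (Finset (ZMod (m * n + 2)))) : Prop :=
  NonCrossingMDiags m n S ∧ ∀ S', NonCrossingMDiags m n S' → S ⊆ S' → S' = S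

def LinGood (m a i : ℕ) (F : Finset (ℕ × ℕ)) : Prop :=
  (∀ p ∈ F, a ≤ p.1 ∧ p.2 ≤ a + m * i + 1 ∧ ∃ l, 1 ≤ l ∧ p.2 = p.1 + m * l + 1) ∧
    ∀ p ∈ F, ∀ q ∈ F, ¬ (p.1 < q.1 ∧ q.1 < p.2 ∧ p.2 < q.2)

lemma linGood_insert {m a i : ℕ} {F : Finset (ℕ × ℕ)} (hF : LinGood m a i F) (p : ℕ × ℕ)
    (h1 : a ≤ p.1 ∧ p.2 ≤ a + m * i + 1 ∧ ∃ l, 1 ≤ l ∧ p.2 = p.1 + m * l + 1)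
    (h2 : ∀ q ∈ F, ¬ (p.1 < q.1 ∧ q.1 < p.2 ∧ p.2 < q.2) ∧ ¬ (q.1 < p.1 ∧ p.1 < q.2 ∧ q.2 < p.2)) :
    LinGood m a i (insert p F) := by
  refine ⟨?_, ?_⟩
  · intro q hq
    rcases Finset.mem_insert.1 hq with rfl | hq
    · exact h1
    · exact hF.1 q hq
  · intro q hq r hr
    rcases Finset.mem_insert.1 hq with hq1 | hq1 <;> rcases Finset.mem_insert.1 hr with hr1 | hr1
    · subst hq1
      subst hr1
      omega
    · subst hq1
      exact (h2 r hr1).1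
    · subst hr1
      exact (h2 q hq1).2
    · exact hF.2 q hq1 r hr1

lemma linGood_main (m : ℕ) (hm : 1 ≤ m) : ∀ (i a : ℕ) (F : Finset (ℕ × ℕ)), LinGood m a i F →
    F.card ≤ i ∧ (F.card < i → ∃ p, p ∉ F ∧ LinGood m a i (insert p F)) := by
  intro i
  induction i using Nat.strong_induction_on with
  | _ i ih =>
  intro a F hF
  by_cases hex : ∃ p ∈ F, p ≠ (a, a + m * i + 1)
  · obtain ⟨⟨x, y⟩, hp, hne⟩ := hex
    obtain ⟨hax, hy, j, hj, hxy⟩ := hF.1 _ hp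
    simp only at hax hy hxy
    have hji : j < i := by
      by_contra hcon
      have : m * i ≤ m * j := Nat.mul_le_mul_left m (by omega)
      apply hne
      ext <;> simp <;> omega
    obtain ⟨k, rfl⟩ : ∃ k, i = j + k := ⟨i - j, by omega⟩
    have hk : 1 ≤ k := by omega
    have hmj : m * (j + k) = m * j + m * k := by ring
    have hmj1 : 1 ≤ m * j := Nat.mul_pos hm hj
    classical
    set Fin' := F.filter (fun p => x ≤ p.1 ∧ p.2 ≤ y) with hFin
    set Fo := F.filter (fun p => ¬ (x ≤ p.1 ∧ p.2 ≤ y)) with hFo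
    have hcard : Fin'.card + Fo.card = F.card := Finset.card_filter_add_card_filter_not _
    have gin : LinGood m x j Fin' := by
      refine ⟨?_, ?_⟩
      · intro p hp
        rw [hFin, Finset.mem_filter] at hp
        exact ⟨hp.2.1, by omega, (hF.1 p hp.1).2.2⟩
      · intro p hp q hq
        exact hF.2 p (Finset.mem_filter.1 hp).1 q (Finset.mem_filter.1 hq).1
    -- the outside vertices
    have hout : ∀ p ∈ Fo, p.1 < p.2 ∧ (p.1 ≤ x ∨ y ≤ p.1) ∧ (p.2 ≤ x ∨ y ≤ p.2) := by
      intro p hp'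
      rw [hFo, Finset.mem_filter] at hp'
      obtain ⟨_, _, l, hl, hl2⟩ := hF.1 p hp'.1
      have h1 := hF.2 p hp'.1 _ hp
      have h2 := hF.2 _ hp p hp'.1
      have h3 := hp'.2
      simp only at h1 h2
      omega
    let φ : ℕ → ℕ := fun v => if v ≤ x then v else v - m * j
    let g : ℕ × ℕ → ℕ × ℕ := fun p => (φ p.1, φ p.2)
    have hginj : Set.InjOn g (Fo : Set (ℕ × ℕ)) := by
      rintro ⟨p1, p2⟩ hp1 ⟨q1, q2⟩ hq1 he
      have := hout _ hp1
      have := hout _ hq1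
      simp only [g, φ, Prod.mk.injEq] at *
      obtain ⟨e1, e2⟩ := he
      constructor
      · split_ifs at e1 <;> omega
      · split_ifs at e2 <;> omega
    have gout : LinGood m a k (Fo.image g) := by
      refine ⟨?_, ?_⟩
      · intro q hq
        obtain ⟨p, hp', rfl⟩ := Finset.mem_image.1 hq
        have ho := hout p hp'
        rw [hFo, Finset.mem_filter] at hp'
        obtain ⟨b1, b2, l, hl, hl2⟩ := hF.1 p hp'.1
        simp only [g, φ]
        refine ⟨by split_ifs <;> omega, by split_ifs <;> omega, ?_⟩
        by_cases hc : p.1 ≤ x ∧ y ≤ p.2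
        · have hjl : j < l := by
            by_contra hcon
            have : m * l ≤ m * j := Nat.mul_le_mul_left m (by omega)
            apply hp'.2
            omega
          obtain ⟨l', rfl⟩ : ∃ k, l = j + k := ⟨l - j, by omega⟩
          have : m * (j + l') = m * j + m * l' := by ring
          refine ⟨l', by omega, ?_⟩
          split_ifs <;> omega
        · refine ⟨l, hl, ?_⟩
          split_ifs <;> omega
      · intro q hq r hr
        obtain ⟨p, hp', rfl⟩ := Finset.mem_image.1 hq
        obtain ⟨s, hs', rfl⟩ := Finset.mem_image.1 hr
        have ho := hout p hp'
        have ho' := hout s hs'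
        have := hF.2 p (Finset.mem_filter.1 hp').1 s (Finset.mem_filter.1 hs').1
        simp only [g, φ]
        split_ifs <;> omega
    have hci : (Fo.image g).card = Fo.card := Finset.card_image_of_injOn hginj
    obtain ⟨u1, e1⟩ := ih j hji x Fin' gin
    obtain ⟨u2, e2⟩ := ih k (by omega) a _ gout
    rw [hci] at u2 e2
    refine ⟨by omega, fun hlt => ?_⟩
    by_cases hc : Fin'.card < j
    · obtain ⟨p, hpn, hpg⟩ := e1 hc
      obtain ⟨b1, b2, b3⟩ := hpg.1 p (Finset.mem_insert_self _ _)
      refine ⟨p, fun h => hpn (Finset.mem_filter.2 ⟨h, by omega⟩), linGood_insert hF p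
        ⟨by omega, by omega, b3⟩ ?_⟩
      intro q hq
      by_cases hqi : x ≤ q.1 ∧ q.2 ≤ y
      · have hqf : q ∈ Fin' := Finset.mem_filter.2 ⟨hq, hqi⟩
        exact ⟨hpg.2 p (Finset.mem_insert_self _ _) q (Finset.mem_insert_of_mem hqf),
          hpg.2 q (Finset.mem_insert_of_mem hqf) p (Finset.mem_insert_self _ _)⟩
      · have := hout q (Finset.mem_filter.2 ⟨hq, hqi⟩)
        omega
    · obtain ⟨p, hpn, hpg⟩ := e2 (by omega)
      obtain ⟨b1, b2, l, hl, hl2⟩ := hpg.1 p (Finset.mem_insert_self _ _)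
      have hml : 1 ≤ m * l := Nat.mul_pos hm hl
      let ψ : ℕ → ℕ := fun v => if v ≤ x then v else v + m * j
      have hψ : ∀ v, φ (ψ v) = v := by
        intro v
        simp only [φ, ψ]
        split_ifs <;> omega
      have hψo : ∀ v, ψ v ≤ x ∨ y ≤ ψ v := by
        intro v
        simp only [ψ]
        split_ifs <;> omega
      have hnot : ¬ (x ≤ ψ p.1 ∧ ψ p.2 ≤ y) := by
        simp only [ψ]
        split_ifs <;> omega
      have hlt' : ψ p.1 < ψ p.2 := by
        simp only [ψ]
        split_ifs <;> omega
      refine ⟨(ψ p.1, ψ p.2), fun h => hpn ?_, linGood_insert hF _ ⟨?_, ?_, ?_⟩ ?_⟩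
      · refine Finset.mem_image.2 ⟨_, Finset.mem_filter.2 ⟨h, hnot⟩, ?_⟩
        simp only [g, hψ]
      · simp only [ψ]
        split_ifs <;> omega
      · simp only [ψ]
        split_ifs <;> omega
      · by_cases hcc : p.1 ≤ x ∧ x < p.2
        · refine ⟨l + j, by omega, ?_⟩
          have : m * (l + j) = m * l + m * j := by ring
          simp only [ψ]
          split_ifs <;> omega
        · refine ⟨l, by omega, ?_⟩
          simp only [ψ]
          split_ifs <;> omega
      · intro q hq
        have o1 := hψo p.1
        have o2 := hψo p.2
        by_cases hqi : x ≤ q.1 ∧ q.2 ≤ y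
        · simp only
          omega
        · have hqf : q ∈ Fo := Finset.mem_filter.2 ⟨hq, hqi⟩
          have ho := hout q hqf
          have c1 := hpg.2 p (Finset.mem_insert_self _ _) (g q)
            (Finset.mem_insert_of_mem (Finset.mem_image_of_mem _ hqf))
          have c2 := hpg.2 (g q) (Finset.mem_insert_of_mem (Finset.mem_image_of_mem _ hqf))
            p (Finset.mem_insert_self _ _)
          have m1 := hψ p.1
          have m2 := hψ p.2
          generalize ψ p.1 = P1 at *
          generalize ψ p.2 = P2 at *
          simp only [g] at c1 c2
          rw [← m1, ← m2] at c1 c2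
          simp only [φ] at c1 c2
          clear_value φ
          constructor
          · split_ifs at c1 <;> omega
          · split_ifs at c2 <;> omega
  · push Not at hex
    have hsub : F ⊆ {(a, a + m * i + 1)} := fun p hp => Finset.mem_singleton.2 (hex p hp)
    have hc1 := Finset.card_le_card hsub
    rw [Finset.card_singleton] at hc1
    have h0 : i = 0 → F.card = 0 := by
      rintro rfl
      rw [Finset.card_eq_zero, Finset.eq_empty_iff_forall_notMem]
      intro p hp
      obtain ⟨b1, b2, l, hl, hl2⟩ := hF.1 p hp
      have hml : 1 ≤ m * l := Nat.mul_pos hm hl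
      omega
    refine ⟨by omega, fun hlt => ?_⟩
    by_cases hF0 : F.card = 0
    · rw [Finset.card_eq_zero] at hF0
      subst hF0
      refine ⟨(a, a + m * i + 1), by simp, linGood_insert hF _ ⟨le_refl _, le_refl _, i, by omega, rfl⟩
        (by simp)⟩
    · have hmi : m * 2 ≤ m * i := Nat.mul_le_mul_left m (by omega)
      refine ⟨(a, a + m * 1 + 1), fun h => ?_, linGood_insert hF _
        ⟨le_refl _, by simp only; omega, 1, le_refl _, rfl⟩ ?_⟩
      · have := hex _ h
        simp only [Prod.mk.injEq] at this
        omega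
      · intro q hq
        rw [hex q hq]
        simp only
        omega

lemma zval_sub {N : ℕ} (hN : 2 ≤ N) (a b : ℕ) (ha : a < N) (hb : b < N) :
    ((b : ZMod N) - (a : ZMod N)).val = if a ≤ b then b - a else N + b - a := by
  haveI : NeZero N := ⟨by omega⟩
  split_ifs with h
  · rw [← Nat.cast_sub h, ZMod.val_natCast, Nat.mod_eq_of_lt (by omega)]
  · have : ((b : ZMod N) - (a : ZMod N)) = ((N + b - a : ℕ) : ZMod N) := by
      rw [Nat.cast_sub (by omega)]
      simp
    rw [this, ZMod.val_natCast, Nat.mod_eq_of_lt (by omega)]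

lemma inOpenArc_iff {N : ℕ} (hN : 2 ≤ N) (a b x : ZMod N) :
    InOpenArc a b x ↔ 0 < (x - a).val ∧ (x - a).val < (b - a).val := by
  haveI : NeZero N := ⟨by omega⟩
  constructor
  · rintro ⟨k, h1, h2, rfl⟩
    have := ZMod.val_lt (b - a)
    rw [add_sub_cancel_left, ZMod.val_natCast, Nat.mod_eq_of_lt (by omega)]
    exact ⟨h1, h2⟩
  · rintro ⟨h1, h2⟩
    exact ⟨_, h1, h2, by simp⟩

def pr (N : ℕ) (p : ℕ × ℕ) : Finset (ZMod N) := {(p.1 : ZMod N), (p.2 : ZMod N)}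

lemma cast_inj' {N a b : ℕ} (ha : a < N) (hb : b < N) (h : (a : ZMod N) = b) : a = b := by
  rw [ZMod.natCast_eq_natCast_iff'] at h
  rwa [Nat.mod_eq_of_lt ha, Nat.mod_eq_of_lt hb] at h

lemma pair_cases {α : Type*} [DecidableEq α] {a b c d : α} (h : ({a, b} : Finset α) = {c, d}) :
    (a = c ∧ b = d) ∨ (a = d ∧ b = c) := by
  have h2 : (({a, b} : Finset α) : Set α) = (({c, d} : Finset α) : Set α) := by rw [h]
  simp only [Finset.coe_insert, Finset.coe_singleton] at h2
  exact Set.pair_eq_pair_iff.1 h2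

lemma pr_inj {N : ℕ} {p q : ℕ × ℕ} (hp : p.1 < p.2) (hp2 : p.2 < N) (hq : q.1 < q.2)
    (hq2 : q.2 < N) (h : pr N p = pr N q) : p = q := by
  rcases pair_cases h with ⟨h1, h2⟩ | ⟨h1, h2⟩
  · exact Prod.ext (cast_inj' (by omega) (by omega) h1) (cast_inj' (by omega) (by omega) h2)
  · have := cast_inj' (by omega) (by omega) h1
    have := cast_inj' (by omega) (by omega) h2
    omega

lemma crosses_iff {N : ℕ} (hN : 2 ≤ N) {p q : ℕ × ℕ} (hp : p.1 < p.2) (hp2 : p.2 < N)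
    (hq : q.1 < q.2) (hq2 : q.2 < N) : Crosses (pr N p) (pr N q) ↔
      (p.1 < q.1 ∧ q.1 < p.2 ∧ p.2 < q.2) ∨ (q.1 < p.1 ∧ p.1 < q.2 ∧ q.2 < p.2) := by
  have hp1 : p.1 < N := by omega
  have hq1 : q.1 < N := by omega
  constructor
  · rintro ⟨a, b, c, d, h1, h2, h3, h4⟩
    rw [inOpenArc_iff hN] at h3 h4
    rcases pair_cases h1 with ⟨rfl, rfl⟩ | ⟨rfl, rfl⟩ <;>
    rcases pair_cases h2 with ⟨rfl, rfl⟩ | ⟨rfl, rfl⟩ <;>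
    · simp only [zval_sub hN, hp1, hp2, hq1, hq2] at h3 h4
      split_ifs at h3 h4 <;> omega
  · rintro (h | h)
    · refine ⟨p.1, p.2, q.1, q.2, rfl, rfl, ?_, ?_⟩ <;>
      · rw [inOpenArc_iff hN]
        simp only [zval_sub hN, hp1, hp2, hq1, hq2]
        split_ifs <;> omega
    · refine ⟨p.1, p.2, q.2, q.1, rfl, Finset.pair_comm _ _, ?_, ?_⟩ <;>
      · rw [inOpenArc_iff hN]
        simp only [zval_sub hN, hp1, hp2, hq1, hq2]
        split_ifs <;> omega

lemma val_nc {N k : ℕ} (h : k < N) : ((k : ℕ) : ZMod N).val = k := by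
  rw [ZMod.val_natCast, Nat.mod_eq_of_lt h]

lemma mdiag_exists {m n : ℕ} (hn : 2 ≤ n) {D : Finset (ZMod (m * n + 2))}
    (h : IsMDiag m n D) : ∃ p : ℕ × ℕ, p.1 < p.2 ∧ p.2 < m * n + 2 ∧ D = pr _ p ∧
      ∃ l, 1 ≤ l ∧ l ≤ n - 1 ∧ p.2 = p.1 + m * l + 1 := by
  obtain ⟨a, b, rfl, hab, -, -, i, hi, hin, he⟩ := h
  have hN : 2 ≤ m * n + 2 := by omega
  have hil : m * i ≤ m * n := Nat.mul_le_mul_left m (by omega)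
  have he2 : (b - a).val = m * i + 1 := by rw [he, val_nc (by omega)]
  have ha := ZMod.val_lt a
  have hb := ZMod.val_lt b
  have key := zval_sub hN a.val b.val ha hb
  rw [ZMod.natCast_zmod_val, ZMod.natCast_zmod_val, he2] at key
  split_ifs at key with hc
  · exact ⟨(a.val, b.val), by simp only; omega, hb, by simp [pr], i, hi, hin, by simp only; omega⟩
  · obtain ⟨k, rfl⟩ : ∃ k, n = i + k := ⟨n - i, by omega⟩
    have : m * (i + k) = m * i + m * k := by ring
    exact ⟨(b.val, a.val), by simp only; omega, ha, by simp [pr, Finset.pair_comm],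
      k, by omega, by omega, by simp only; omega⟩

lemma mdiag_of {m n : ℕ} (hm : 1 ≤ m) (hn : 2 ≤ n) {p : ℕ × ℕ} (hp2 : p.2 < m * n + 2)
    {l : ℕ} (hl : 1 ≤ l) (hln : l ≤ n - 1) (h : p.2 = p.1 + m * l + 1) :
    IsMDiag m n (pr _ p) := by
  have hN : 2 ≤ m * n + 2 := by omega
  have hp1 : p.1 < m * n + 2 := by omega
  have h1 : 1 ≤ m * l := Nat.mul_pos hm hl
  have h2 : m * (l + 1) ≤ m * n := Nat.mul_le_mul_left m (by omega)
  have h3 : m * (l + 1) = m * l + m := by ring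
  have v1 : (1 : ZMod (m * n + 2)).val = 1 := by
    have := val_nc (N := m * n + 2) (k := 1) (by omega)
    simpa using this
  refine ⟨p.1, p.2, rfl, ?_, ?_, ?_, l, hl, hln, ?_⟩
  · intro hh
    have := cast_inj' hp1 hp2 hh
    omega
  · intro hh
    have := congrArg ZMod.val hh
    rw [zval_sub hN _ _ hp1 hp2, v1] at this
    split_ifs at this <;> omega
  · intro hh
    have := congrArg ZMod.val hh
    rw [zval_sub hN _ _ hp2 hp1, v1] at this
    split_ifs at this <;> omega
  · rw [h]
    push_cast
    ring

lemma extract {m n : ℕ} (hm : 1 ≤ m) (hn : 2 ≤ n)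
    (S : Finset (Finset (ZMod (m * n + 2)))) (hS : NonCrossingMDiags m n S) :
    S.card ≤ n - 1 ∧ (S.card < n - 1 → ∃ D, D ∉ S ∧ NonCrossingMDiags m n (insert D S)) := by
  classical
  have hN : 2 ≤ m * n + 2 := by omega
  let F : Finset (ℕ × ℕ) := (Finset.range (m * n + 2) ×ˢ Finset.range (m * n + 2)).filter
    (fun p => p.1 < p.2 ∧ pr (m * n + 2) p ∈ S)
  have hF : ∀ p, p ∈ F ↔ p.1 < p.2 ∧ p.2 < (m * n + 2) ∧ pr (m * n + 2) p ∈ S := by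
    intro p
    simp only [F, Finset.mem_filter, Finset.mem_product, Finset.mem_range]
    constructor
    · rintro ⟨⟨_, h1⟩, h2, h3⟩
      exact ⟨h2, h1, h3⟩
    · rintro ⟨h1, h2, h3⟩
      exact ⟨⟨by omega, h2⟩, h1, h3⟩
  have himg : F.image (pr (m * n + 2)) = S := by
    ext D
    rw [Finset.mem_image]
    constructor
    · rintro ⟨p, hp, rfl⟩
      exact ((hF p).1 hp).2.2
    · intro hD
      obtain ⟨p, h1, h2, rfl, -⟩ := mdiag_exists hn (hS.1 D hD)
      exact ⟨p, (hF p).2 ⟨h1, h2, hD⟩, rfl⟩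
  have hcard : F.card = S.card := by
    rw [← himg, Finset.card_image_of_injOn]
    intro p hp q hq h
    have hp' := (hF p).1 hp
    have hq' := (hF q).1 hq
    exact pr_inj hp'.1 hp'.2.1 hq'.1 hq'.2.1 h
  have hFl : ∀ p ∈ F, ∃ l, 1 ≤ l ∧ l ≤ n - 1 ∧ p.2 = p.1 + m * l + 1 := by
    intro p hp
    have hp' := (hF p).1 hp
    obtain ⟨q, h1, h2, h3, h4⟩ := mdiag_exists hn (hS.1 _ hp'.2.2)
    rw [pr_inj hp'.1 hp'.2.1 h1 h2 h3]
    exact h4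
  have htop : (0, m * n + 1) ∉ F := by
    intro h
    obtain ⟨l, h1, h2, h3⟩ := hFl _ h
    have : m * (l + 1) ≤ m * n := Nat.mul_le_mul_left m (by omega)
    have : m * (l + 1) = m * l + m := by ring
    simp only at h3
    omega
  have gF : LinGood m 0 n F := by
    refine ⟨?_, ?_⟩
    · intro p hp
      obtain ⟨l, h1, h2, h3⟩ := hFl _ hp
      have := ((hF p).1 hp).2.1
      exact ⟨by omega, by omega, l, h1, h3⟩
    · intro p hp q hq hx
      have hp' := (hF p).1 hp
      have hq' := (hF q).1 hq
      refine hS.2 _ hp'.2.2 _ hq'.2.2 ?_ ((crosses_iff hN hp'.1 hp'.2.1 hq'.1 hq'.2.1).2 (Or.inl hx))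
      intro h
      have := pr_inj hp'.1 hp'.2.1 hq'.1 hq'.2.1 h
      rw [this] at hx
      omega
  have gT : LinGood m 0 n (insert (0, m * n + 1) F) := by
    refine linGood_insert gF _ ⟨le_refl _, by simp only; omega, n, by omega, by simp only; omega⟩ ?_
    intro q hq
    have := ((hF q).1 hq).2.1
    simp only
    omega
  obtain ⟨c1, c2⟩ := linGood_main m hm n 0 _ gT
  rw [Finset.card_insert_of_notMem htop, hcard] at c1 c2
  refine ⟨by omega, fun hlt => ?_⟩
  obtain ⟨p, hpn, hpg⟩ := c2 (by omega)
  rw [Finset.mem_insert, not_or] at hpn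
  obtain ⟨-, b2, l, hl, hl2⟩ := hpg.1 p (Finset.mem_insert_self _ _)
  have hp12 : p.1 < p.2 := by omega
  have hp2 : p.2 < (m * n + 2) := by omega
  have hln : l ≤ n - 1 := by
    by_contra hcon
    have : m * n ≤ m * l := Nat.mul_le_mul_left m (by omega)
    apply hpn.1
    ext <;> simp only <;> omega
  have hcr : ∀ q ∈ F, ¬ Crosses (pr (m * n + 2) p) (pr (m * n + 2) q) ∧ ¬ Crosses (pr (m * n + 2) q) (pr (m * n + 2) p) := by
    intro q hq
    have hq' := (hF q).1 hq
    rw [crosses_iff hN hp12 hp2 hq'.1 hq'.2.1, crosses_iff hN hq'.1 hq'.2.1 hp12 hp2]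
    have hqm : q ∈ insert p (insert (0, m * n + 1) F) :=
      Finset.mem_insert_of_mem (Finset.mem_insert_of_mem hq)
    have x1 := hpg.2 p (Finset.mem_insert_self _ _) q hqm
    have x2 := hpg.2 q hqm p (Finset.mem_insert_self _ _)
    exact ⟨not_or.2 ⟨x1, x2⟩, not_or.2 ⟨x2, x1⟩⟩
  refine ⟨pr (m * n + 2) p, fun h => hpn.2 ((hF p).2 ⟨hp12, hp2, h⟩), ?_, ?_⟩
  · intro D hD
    rcases Finset.mem_insert.1 hD with rfl | hD
    · exact mdiag_of hm hn hp2 hl hln hl2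
    · exact hS.1 D hD
  · intro D hD E hE hne
    rcases Finset.mem_insert.1 hD with h1 | h1 <;> rcases Finset.mem_insert.1 hE with h2 | h2
    · exact absurd (h1.trans h2.symm) hne
    · rw [← himg] at h2
      obtain ⟨q, hq, rfl⟩ := Finset.mem_image.1 h2
      rw [h1]
      exact (hcr q hq).1
    · rw [← himg] at h1
      obtain ⟨q, hq, rfl⟩ := Finset.mem_image.1 h1
      rw [h2]
      exact (hcr q hq).2
    · exact hS.2 D h1 E h2 hne

theorem angulation_iff_card (m n : ℕ) (hm : 1 ≤ m) (hn : 2 ≤ n)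
    (S : Finset (Finset (ZMod (m * n + 2)))) (hS : NonCrossingMDiags m n S) :
    ((∀ S', NonCrossingMDiags m n S' → S ⊆ S' → S' = S) ↔ S.card = n - 1) ∧
      S.card ≤ n - 1 := by
  obtain ⟨h1, h2⟩ := extract hm hn S hS
  refine ⟨⟨fun hmax => ?_, fun hc S' hS' hsub => ?_⟩, h1⟩
  · by_contra hne
    obtain ⟨D, hD, hg⟩ := h2 (by omega)
    apply hD
    rw [← hmax _ hg (Finset.subset_insert _ _)]
    exact Finset.mem_insert_self _ _
  · exact (Finset.eq_of_subset_of_card_le hsub (by rw [hc]; exact (extract hm hn S' hS').1)).symm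
end

section
/- Fix integers m ≥ 1 and n ≥ 2 and set N = m·n + 2. Every set of n − 2 pairwise noncrossing m-diagonals of the N-gon is contained in exactly m + 1 distinct (m+2)-angulations. In particular, if Δ is an (m+2)-angulation and D ∈ Δ, then there are exactly m m-diagonals D′ ≠ D such that (Δ \ {D}) ∪ {D′} is again an (m+2)-angulation. -/
namespace CC

def inner (V : Finset ℕ) (p : ℕ × ℕ) : Finset ℕ := V.filter (fun x => p.1 < x ∧ x < p.2)

def Dg (m k : ℕ) (V : Finset ℕ) (p : ℕ × ℕ) : Prop :=
  p.1 ∈ V ∧ p.2 ∈ V ∧ p.1 < p.2 ∧ ∃ i, 0 < i ∧ i < k ∧ (inner V p).card = m * i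

def Cr (p q : ℕ × ℕ) : Prop :=
  (p.1 < q.1 ∧ q.1 < p.2 ∧ p.2 < q.2) ∨ (q.1 < p.1 ∧ p.1 < q.2 ∧ q.2 < p.2)

def Cpt (m k : ℕ) (V : Finset ℕ) (S : Finset (ℕ × ℕ)) : Set (ℕ × ℕ) :=
  {e | Dg m k V e ∧ e ∉ S ∧ ∀ f ∈ S, ¬ Cr e f}

lemma Cr_symm {p q : ℕ × ℕ} (h : Cr p q) : Cr q p := by
  unfold Cr at *; omega

def V1 (V : Finset ℕ) (d : ℕ × ℕ) := V.filter (fun x => d.1 ≤ x ∧ x ≤ d.2)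
def V2 (V : Finset ℕ) (d : ℕ × ℕ) := V.filter (fun x => x ≤ d.1 ∨ d.2 ≤ x)

lemma cpt_finite (m k V S) : (Cpt m k V S).Finite := by
  apply Set.Finite.subset (V ×ˢ V).finite_toSet
  rintro ⟨a, b⟩ ⟨⟨h1, h2, _⟩, _⟩
  simp only [Finset.coe_product, Set.mem_prod, Finset.mem_coe]
  exact ⟨h1, h2⟩

lemma card_V1 {V : Finset ℕ} {d : ℕ × ℕ} (h1 : d.1 ∈ V) (h2 : d.2 ∈ V) (h : d.1 < d.2) :
    (V1 V d).card = (inner V d).card + 2 := by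
  have : V1 V d = insert d.1 (insert d.2 (inner V d)) := by
    ext x
    simp only [V1, inner, Finset.mem_filter, Finset.mem_insert]
    constructor
    · rintro ⟨hx, hy, hz⟩
      rcases eq_or_lt_of_le hy with e | e
      · left; exact e.symm
      rcases eq_or_lt_of_le hz with e' | e'
      · right; left; exact e'
      · right; right; exact ⟨hx, e, e'⟩
    · rintro (rfl | rfl | ⟨a, b, c⟩)
      · exact ⟨h1, le_refl _, h.le⟩
      · exact ⟨h2, h.le, le_refl _⟩
      · exact ⟨a, b.le, c.le⟩
  rw [this, Finset.card_insert_of_notMem, Finset.card_insert_of_notMem]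
  · simp [inner]
  · simp [inner]; omega

lemma card_V2 {V : Finset ℕ} {d : ℕ × ℕ} :
    (V2 V d).card + (inner V d).card = V.card := by
  have := Finset.card_filter_add_card_filter_not (s := V) (fun x => x ≤ d.1 ∨ d.2 ≤ x)
  rw [← this, V2, inner]
  congr 2
  ext x
  simp only [Finset.mem_filter]
  grind

lemma inner_card_add {V : Finset ℕ} {e : ℕ × ℕ} (h1 : e.1 ∈ V) (h2 : e.2 ∈ V) (h : e.1 < e.2) :
    (inner V e).card + 2 ≤ V.card := by
  rw [← card_V1 h1 h2 h]; exact Finset.card_le_card (Finset.filter_subset _ _)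

lemma inner_card_add3 {V : Finset ℕ} {e : ℕ × ℕ} (h1 : e.1 ∈ V) (h2 : e.2 ∈ V) (h : e.1 < e.2)
    {x : ℕ} (hx : x ∈ V) (hx' : x < e.1 ∨ e.2 < x) :
    (inner V e).card + 3 ≤ V.card := by
  have : (V1 V e).card < V.card := by
    apply Finset.card_lt_card
    refine Finset.filter_ssubset.2 ⟨x, hx, by omega⟩
  rw [card_V1 h1 h2 h] at this; omega

/-- splitting of diagonals -/
lemma dg_V1 {m k i : ℕ} (hm : 1 ≤ m) {V : Finset ℕ} {d e : ℕ × ℕ} (hik : i < k)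
    (hd1 : d.1 ∈ V) (hd2 : d.2 ∈ V) (hd : d.1 < d.2) (hi : (inner V d).card = m * i) :
    Dg m i (V1 V d) e ↔ (Dg m k V e ∧ e ≠ d ∧ d.1 ≤ e.1 ∧ e.2 ≤ d.2) := by
  have key : d.1 ≤ e.1 → e.2 ≤ d.2 → inner (V1 V d) e = inner V e := by
    intro h1 h2
    ext x; simp only [inner, V1, Finset.mem_filter]
    constructor
    · rintro ⟨⟨a, b⟩, c⟩; exact ⟨a, c⟩
    · rintro ⟨a, c⟩; exact ⟨⟨a, by omega⟩, c⟩
  constructor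
  · rintro ⟨h1, h2, h3, j, hj0, hj, hc⟩
    simp only [V1, Finset.mem_filter] at h1 h2
    rw [key h1.2.1 h2.2.2] at hc
    refine ⟨⟨h1.1, h2.1, h3, j, hj0, by omega, hc⟩, ?_, h1.2.1, h2.2.2⟩
    rintro rfl
    rw [hi] at hc
    have := Nat.eq_of_mul_eq_mul_left (by omega) hc
    omega
  · rintro ⟨⟨h1, h2, h3, j, hj0, hj, hc⟩, hne, ha, hb⟩
    have m1 : e.1 ∈ V1 V d := by simp only [V1, Finset.mem_filter]; exact ⟨h1, by omega⟩
    have m2 : e.2 ∈ V1 V d := by simp only [V1, Finset.mem_filter]; exact ⟨h2, by omega⟩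
    have m3 : d.1 ∈ V1 V d := by simp only [V1, Finset.mem_filter]; exact ⟨hd1, by omega⟩
    have m4 : d.2 ∈ V1 V d := by simp only [V1, Finset.mem_filter]; exact ⟨hd2, by omega⟩
    refine ⟨m1, m2, h3, j, hj0, ?_, by rw [key ha hb, hc]⟩
    have hc' : (inner (V1 V d) e).card + 3 ≤ (V1 V d).card := by
      by_cases h : d.1 = e.1
      · apply inner_card_add3 m1 m2 h3 m4
        right
        by_contra h'
        exact hne (Prod.ext h.symm (by omega))
      · apply inner_card_add3 m1 m2 h3 m3; left; omega
    rw [key ha hb, card_V1 hd1 hd2 hd, hc, hi] at hc'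
    exact lt_of_mul_lt_mul_left (a := m) (by omega) (by omega)

lemma dg_V2 {m k i : ℕ} (hm : 1 ≤ m) {V : Finset ℕ} {d e : ℕ × ℕ} (hV : V.card = m * k + 2)
    (hi0 : 0 < i) (hik : i < k)
    (hd1 : d.1 ∈ V) (hd2 : d.2 ∈ V) (hd : d.1 < d.2) (hi : (inner V d).card = m * i) :
    Dg m (k - i) (V2 V d) e ↔ (Dg m k V e ∧ e ≠ d ∧ (e.1 ≤ d.1 ∨ d.2 ≤ e.1) ∧
      (e.2 ≤ d.1 ∨ d.2 ≤ e.2)) := by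
  have c2 : (V2 V d).card = m * (k - i) + 2 := by
    have := card_V2 (V := V) (d := d)
    obtain ⟨l, rfl⟩ := Nat.exists_eq_add_of_lt hik
    rw [hi, hV] at this
    have : i + l + 1 - i = l + 1 := by omega
    rw [this]; nlinarith
  have key1 : e.2 ≤ d.1 ∨ d.2 ≤ e.1 → inner (V2 V d) e = inner V e := by
    intro h
    ext x; simp only [inner, V2, Finset.mem_filter]
    constructor
    · rintro ⟨⟨a, b⟩, c⟩; exact ⟨a, c⟩
    · rintro ⟨a, c⟩; exact ⟨⟨a, by omega⟩, c⟩
  have key2 : e.1 ≤ d.1 → d.2 ≤ e.2 →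
      (inner V e).card = (inner (V2 V d) e).card + m * i := by
    intro h1 h2
    rw [← hi, ← Finset.card_union_of_disjoint]
    · congr 1
      ext x; simp only [inner, V2, Finset.mem_filter, Finset.mem_union]
      constructor
      · rintro ⟨a, b⟩
        by_cases h : x ≤ d.1 ∨ d.2 ≤ x
        · left; exact ⟨⟨a, h⟩, b⟩
        · right; exact ⟨a, by omega⟩
      · rintro (⟨⟨a, b⟩, c⟩ | ⟨a, b⟩)
        · exact ⟨a, c⟩
        · exact ⟨a, by omega⟩
    · rw [Finset.disjoint_left]
      intro x; simp only [inner, V2, Finset.mem_filter]; omega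
  have m3 : d.1 ∈ V2 V d := by simp only [V2, Finset.mem_filter]; exact ⟨hd1, by omega⟩
  have m4 : d.2 ∈ V2 V d := by simp only [V2, Finset.mem_filter]; exact ⟨hd2, by omega⟩
  constructor
  · rintro ⟨h1, h2, h3, j, hj0, hj, hc⟩
    simp only [V2, Finset.mem_filter] at h1 h2
    have hne : e ≠ d := by
      rintro rfl
      have : inner (V2 V e) e = ∅ := by
        apply Finset.eq_empty_of_forall_notMem
        intro x; simp only [inner, V2, Finset.mem_filter]; omega
      rw [this, Finset.card_empty] at hc
      have : 0 < m * j := Nat.mul_pos (by omega) hj0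
      omega
    refine ⟨?_, hne, h1.2, h2.2⟩
    refine ⟨h1.1, h2.1, h3, ?_⟩
    by_cases h : e.2 ≤ d.1 ∨ d.2 ≤ e.1
    · refine ⟨j, hj0, by omega, ?_⟩
      rw [← key1 h, hc]
    · refine ⟨j + i, by omega, by omega, ?_⟩
      rw [key2 (by omega) (by omega), hc]; ring
  · rintro ⟨⟨h1, h2, h3, j, hj0, hj, hc⟩, hne, ha, hb⟩
    have m1 : e.1 ∈ V2 V d := by simp only [V2, Finset.mem_filter]; exact ⟨h1, by omega⟩
    have m2 : e.2 ∈ V2 V d := by simp only [V2, Finset.mem_filter]; exact ⟨h2, by omega⟩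
    refine ⟨m1, m2, h3, ?_⟩
    by_cases h : e.2 ≤ d.1 ∨ d.2 ≤ e.1
    · refine ⟨j, hj0, ?_, by rw [key1 h, hc]⟩
      have hc' : (inner (V2 V d) e).card + 3 ≤ (V2 V d).card := by
        rcases h with h | h
        · exact inner_card_add3 m1 m2 h3 m4 (by omega)
        · exact inner_card_add3 m1 m2 h3 m3 (by omega)
      rw [key1 h, c2, hc] at hc'
      exact lt_of_mul_lt_mul_left (a := m) (by omega) (by omega)
    · have k2 := key2 (by omega) (by omega)
      have pos : 0 < (inner (V2 V d) e).card := by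
        apply Finset.card_pos.2
        by_cases h' : e.1 = d.1
        · refine ⟨d.2, ?_⟩
          rw [inner, Finset.mem_filter]
          refine ⟨m4, by omega, ?_⟩
          by_contra h''
          exact hne (Prod.ext h' (by omega))
        · refine ⟨d.1, ?_⟩
          rw [inner, Finset.mem_filter]
          exact ⟨m3, by omega, by omega⟩
      have hij : i < j := lt_of_mul_lt_mul_left (a := m) (by omega) (by omega)
      refine ⟨j - i, by omega, by omega, ?_⟩
      rw [Nat.mul_sub]; omega

lemma inner_emb {V : Finset ℕ} {c : ℕ} (h : V.card = c) (s t : Fin c) :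
    (inner V (V.orderEmbOfFin h s, V.orderEmbOfFin h t)).card = t - s - 1 := by
  have : inner V (V.orderEmbOfFin h s, V.orderEmbOfFin h t)
      = (Finset.Ioo s t).image (V.orderEmbOfFin h) := by
    ext x
    simp only [inner, Finset.mem_filter, Finset.mem_image, Finset.mem_Ioo]
    constructor
    · rintro ⟨hx, h1, h2⟩
      have : x ∈ Set.range (V.orderEmbOfFin h) := by
        rw [Finset.range_orderEmbOfFin]; exact hx
      obtain ⟨u, rfl⟩ := this
      exact ⟨u, ⟨(V.orderEmbOfFin h).lt_iff_lt.1 h1, (V.orderEmbOfFin h).lt_iff_lt.1 h2⟩, rfl⟩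
    · rintro ⟨u, ⟨h1, h2⟩, rfl⟩
      exact ⟨Finset.orderEmbOfFin_mem _ _ _, by simpa using h1, by simpa using h2⟩
  rw [this, Finset.card_image_of_injective _ (V.orderEmbOfFin h).injective, Fin.card_Ioo]

lemma base_nonempty {m k : ℕ} (hk : 1 < k) {V : Finset ℕ} (hV : V.card = m * k + 2) :
    (Cpt m k V ∅).Nonempty := by
  have hmk : m * 2 ≤ m * k := Nat.mul_le_mul_left _ hk
  refine ⟨(V.orderEmbOfFin hV ⟨0, by omega⟩, V.orderEmbOfFin hV ⟨m + 1, by omega⟩),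
    ⟨Finset.orderEmbOfFin_mem _ _ _, Finset.orderEmbOfFin_mem _ _ _, by simp [Fin.lt_def], 1, by omega, hk, ?_⟩,
    by simp, by simp⟩
  rw [inner_emb]; simp

lemma base_card {m : ℕ} (hm : 1 ≤ m) {V : Finset ℕ} (hV : V.card = m * 2 + 2) :
    (Cpt m 2 V ∅).ncard = m + 1 := by
  have : Cpt m 2 V ∅ = Set.range (fun t : Fin (m + 1) =>
      (V.orderEmbOfFin hV ⟨t, by omega⟩, V.orderEmbOfFin hV ⟨t + m + 1, by omega⟩)) := by
    ext ⟨a, b⟩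
    constructor
    · rintro ⟨⟨h1, h2, h3, i, h0, hi, hc⟩, _⟩
      have h1' : a ∈ Set.range (V.orderEmbOfFin hV) := by
        rw [Finset.range_orderEmbOfFin]; exact h1
      have h2' : b ∈ Set.range (V.orderEmbOfFin hV) := by
        rw [Finset.range_orderEmbOfFin]; exact h2
      obtain ⟨s, rfl⟩ := h1'
      obtain ⟨t, rfl⟩ := h2'
      rw [inner_emb] at hc
      have : i = 1 := by omega
      subst this
      have hst : (t : ℕ) = s + m + 1 := by omega
      refine ⟨⟨s, by omega⟩, ?_⟩
      have : t = ⟨s + m + 1, by omega⟩ := Fin.ext hst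
      simp [this]
    · rintro ⟨t, ht⟩
      simp only [Prod.mk.injEq] at ht
      obtain ⟨rfl, rfl⟩ := ht
      refine ⟨⟨Finset.orderEmbOfFin_mem _ _ _, Finset.orderEmbOfFin_mem _ _ _, ?_, 1, by omega,
        by omega, ?_⟩, by simp, by simp⟩
      · simp only [OrderEmbedding.lt_iff_lt, Fin.mk_lt_mk]; omega
      · rw [inner_emb]; simp only []; omega
  rw [this, ← Set.image_univ, Set.ncard_image_of_injective, Set.ncard_univ]
  · simp
  · intro s t h
    simp only [Prod.mk.injEq, EmbeddingLike.apply_eq_iff_eq, Fin.mk.injEq] at h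
    exact Fin.ext h.1

theorem main (m : ℕ) (hm : 1 ≤ m) : ∀ (c k : ℕ) (V : Finset ℕ) (S : Finset (ℕ × ℕ)), S.card = c →
    1 ≤ k → V.card = m * k + 2 → (∀ e ∈ S, Dg m k V e) → (∀ e ∈ S, ∀ f ∈ S, ¬ Cr e f) →
    S.card + 1 ≤ k ∧ (S.card + 1 = k → Cpt m k V S = ∅) ∧
    (S.card + 2 = k → (Cpt m k V S).ncard = m + 1) ∧
    (S.card + 1 < k → (Cpt m k V S).Nonempty) := by
  intro c
  induction c using Nat.strong_induction_on with
  | _ c ih =>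
  intro k V S hSc hk hV hS hN
  rcases S.eq_empty_or_nonempty with rfl | ⟨d, hdS⟩
  · refine ⟨by simpa using hk, ?_, ?_, ?_⟩
    · intro h
      apply Set.eq_empty_of_forall_notMem
      rintro e ⟨⟨_, _, _, i, h0, h1, _⟩, _⟩
      simp at h; omega
    · intro h
      simp at h; subst h; exact base_card hm hV
    · intro h
      exact base_nonempty (by simpa using h) hV
  obtain ⟨hd1, hd2, hd, i, hi0, hik, hi⟩ := hS d hdS
  have D1 := fun e => dg_V1 (e := e) hm hik hd1 hd2 hd hi
  have D2 := fun e => dg_V2 (e := e) hm hV hi0 hik hd1 hd2 hd hi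
  have cV1 : (V1 V d).card = m * i + 2 := by rw [card_V1 hd1 hd2 hd, hi]
  have cV2 : (V2 V d).card = m * (k - i) + 2 := by
    have := card_V2 (V := V) (d := d)
    have := Nat.mul_le_mul_left m hik.le
    rw [Nat.mul_sub]; omega
  -- trichotomy
  have tri : ∀ e, Dg m k V e → e ≠ d → ¬ Cr e d →
      (Dg m i (V1 V d) e ∨ Dg m (k - i) (V2 V d) e) := by
    intro e he hne hcr
    rw [D1, D2]
    have := he.2.2.1
    unfold Cr at hcr
    by_cases h : d.1 ≤ e.1 ∧ e.2 ≤ d.2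
    · left; exact ⟨he, hne, h⟩
    · right; exact ⟨he, hne, by omega, by omega⟩
  have excl : ∀ e, Dg m i (V1 V d) e → ¬ Dg m (k - i) (V2 V d) e := by
    intro e
    rw [D1, D2]
    rintro ⟨he, hne, h1, h2⟩ ⟨_, _, h3, h4⟩
    have := he.2.2.1
    exact hne (Prod.ext (by omega) (by omega))
  have nocr : ∀ e f, Dg m i (V1 V d) e → Dg m (k - i) (V2 V d) f → ¬ Cr e f := by
    intro e f
    rw [D1, D2]
    rintro ⟨he, hne, h1, h2⟩ ⟨hf, _, h3, h4⟩
    have := he.2.2.1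
    have := hf.2.2.1
    unfold Cr; omega
  classical
  set S1 := S.filter (fun e => Dg m i (V1 V d) e) with hS1
  set S2 := S.filter (fun e => Dg m (k - i) (V2 V d) e) with hS2
  have hSu : S = insert d (S1 ∪ S2) := by
    ext e
    simp only [hS1, hS2, Finset.mem_insert, Finset.mem_union, Finset.mem_filter]
    constructor
    · intro he
      by_cases hed : e = d
      · left; exact hed
      · right
        rcases tri e (hS e he) hed (hN e he d hdS) with h | h
        · left; exact ⟨he, h⟩
        · right; exact ⟨he, h⟩
    · rintro (rfl | ⟨h, _⟩ | ⟨h, _⟩) <;> assumption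
  have hcard : S.card = S1.card + S2.card + 1 := by
    conv_lhs => rw [hSu]
    rw [Finset.card_insert_of_notMem, Finset.card_union_of_disjoint]
    · rw [Finset.disjoint_left]
      intro e h1 h2
      exact excl e (Finset.mem_filter.1 h1).2 (Finset.mem_filter.1 h2).2
    · intro h
      rcases Finset.mem_union.1 h with h | h
      · exact ((D1 d).1 (Finset.mem_filter.1 h).2).2.1 rfl
      · exact ((D2 d).1 (Finset.mem_filter.1 h).2).2.1 rfl
  have I1 := ih S1.card (by omega) i (V1 V d) S1 rfl hi0 cV1
    (fun e he => (Finset.mem_filter.1 he).2)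
    (fun e he f hf => hN e (Finset.mem_filter.1 he).1 f (Finset.mem_filter.1 hf).1)
  have I2 := ih S2.card (by omega) (k - i) (V2 V d) S2 rfl (by omega) cV2
    (fun e he => (Finset.mem_filter.1 he).2)
    (fun e he f hf => hN e (Finset.mem_filter.1 he).1 f (Finset.mem_filter.1 hf).1)
  have hC : Cpt m k V S = Cpt m i (V1 V d) S1 ∪ Cpt m (k - i) (V2 V d) S2 := by
    ext e
    constructor
    · rintro ⟨he, heS, hcr⟩
      have hne : e ≠ d := fun h => heS (h ▸ hdS)
      rcases tri e he hne (hcr d hdS) with h | h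
      · left
        exact ⟨h, fun h' => heS (Finset.mem_filter.1 h').1,
          fun f hf => hcr f (Finset.mem_filter.1 hf).1⟩
      · right
        exact ⟨h, fun h' => heS (Finset.mem_filter.1 h').1,
          fun f hf => hcr f (Finset.mem_filter.1 hf).1⟩
    · rintro (⟨he, heS, hcr⟩ | ⟨he, heS, hcr⟩)
      · have hh := (D1 e).1 he
        refine ⟨hh.1, fun h => heS (Finset.mem_filter.2 ⟨h, he⟩), ?_⟩
        intro f hf
        rw [hSu, Finset.mem_insert, Finset.mem_union] at hf
        rcases hf with rfl | hf | hf
        · have := hh.1.2.2.1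
          have := hh.2.2
          unfold Cr; omega
        · exact hcr f hf
        · exact nocr e f he (Finset.mem_filter.1 hf).2
      · have hh := (D2 e).1 he
        refine ⟨hh.1, fun h => heS (Finset.mem_filter.2 ⟨h, he⟩), ?_⟩
        intro f hf
        rw [hSu, Finset.mem_insert, Finset.mem_union] at hf
        rcases hf with rfl | hf | hf
        · have := hh.1.2.2.1
          have := hh.2.2
          unfold Cr; omega
        · exact fun h => nocr f e (Finset.mem_filter.1 hf).2 he (Cr_symm h)
        · exact hcr f hf
  obtain ⟨a1, b1, c1, e1⟩ := I1
  obtain ⟨a2, b2, c2, e2⟩ := I2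
  rw [hC]
  refine ⟨by omega, ?_, ?_, ?_⟩
  · intro h
    rw [b1 (by omega), b2 (by omega), Set.union_empty]
  · intro h
    by_cases h1 : S1.card + 1 = i
    · rw [b1 h1, Set.empty_union]; exact c2 (by omega)
    · rw [b2 (by omega), Set.union_empty]; exact c1 (by omega)
  · intro h
    by_cases h1 : S1.card + 1 < i
    · exact (e1 h1).mono Set.subset_union_left
    · exact (e2 (by omega)).mono Set.subset_union_right

def ph (N : ℕ) (p : ℕ × ℕ) : Finset (ZMod N) := {(p.1 : ZMod N), (p.2 : ZMod N)}

lemma valsub {N : ℕ} {a b : ℕ} (ha : a < N) (hb : b < N) :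
    ((a : ZMod N) - (b : ZMod N)).val = if b ≤ a then a - b else N + a - b := by
  split_ifs with h
  · rw [← Nat.cast_sub h, ZMod.val_natCast_of_lt (by omega)]
  · have : (a : ZMod N) - b = ((N + a - b : ℕ) : ZMod N) := by
      rw [Nat.cast_sub (by omega)]; simp
    rw [this, ZMod.val_natCast_of_lt (by omega)]

lemma arc_iff {N : ℕ} [NeZero N] (a b x : ZMod N) :
    InOpenArc a b x ↔ 0 < (x - a).val ∧ (x - a).val < (b - a).val := by
  constructor
  · rintro ⟨k, h0, h1, rfl⟩
    have := ZMod.val_lt (b - a)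
    rw [add_sub_cancel_left, ZMod.val_natCast_of_lt (by omega)]
    exact ⟨h0, h1⟩
  · rintro ⟨h0, h1⟩
    exact ⟨_, h0, h1, by simp⟩

lemma arc_nat {N : ℕ} {a b x : ℕ} (ha : a < N) (hb : b < N) (hx : x < N) :
    InOpenArc (a : ZMod N) b x ↔ 0 < (if a ≤ x then x - a else N + x - a) ∧
      (if a ≤ x then x - a else N + x - a) < (if a ≤ b then b - a else N + b - a) := by
  haveI : NeZero N := ⟨by omega⟩
  rw [arc_iff, valsub hx ha, valsub hb ha]

lemma cast_inj {N a b : ℕ} (ha : a < N) (hb : b < N) (h : (a : ZMod N) = b) : a = b := by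
  have := congrArg ZMod.val h
  rwa [ZMod.val_natCast_of_lt ha, ZMod.val_natCast_of_lt hb] at this

lemma pair_eq {α : Type*} [DecidableEq α] {a b c d : α} (h : ({a, b} : Finset α) = {c, d}) :
    (c = a ∧ d = b) ∨ (c = b ∧ d = a) := by
  have h' : ({a, b} : Set α) = {c, d} := by
    have := congrArg (fun s : Finset α => (s : Set α)) h
    simpa using this
  rcases Set.pair_eq_pair_iff.1 h' with ⟨h1, h2⟩ | ⟨h1, h2⟩
  · left; exact ⟨h1.symm, h2.symm⟩
  · right; exact ⟨h2.symm, h1.symm⟩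

lemma ph_inj {N : ℕ} {p q : ℕ × ℕ} (hp : p.1 < p.2) (hp' : p.2 < N) (hq : q.1 < q.2)
    (hq' : q.2 < N) (h : ph N p = ph N q) : p = q := by
  rcases pair_eq h with ⟨h1, h2⟩ | ⟨h1, h2⟩
  · exact Prod.ext (cast_inj (by omega) (by omega) h1).symm
      (cast_inj (by omega) (by omega) h2).symm
  · have := cast_inj (by omega) (by omega) h1
    have := cast_inj (by omega) (by omega) h2
    omega

lemma cr_iff {N : ℕ} {p q : ℕ × ℕ} (hp : p.1 < p.2) (hp' : p.2 < N) (hq : q.1 < q.2)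
    (hq' : q.2 < N) : Crosses (ph N p) (ph N q) ↔ Cr p q := by
  have l1 : p.1 < N := by omega
  have l2 : q.1 < N := by omega
  constructor
  · rintro ⟨a, b, c, d, h1, h2, h3, h4⟩
    unfold Cr
    rcases pair_eq h1 with ⟨rfl, rfl⟩ | ⟨rfl, rfl⟩ <;>
    rcases pair_eq h2 with ⟨rfl, rfl⟩ | ⟨rfl, rfl⟩ <;>
    · rw [arc_nat (by assumption) (by assumption) (by assumption)] at h3 h4
      split_ifs at h3 h4 <;> omega
  · rintro (h | h)
    · refine ⟨p.1, p.2, q.1, q.2, rfl, rfl, ?_, ?_⟩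
      · rw [arc_nat (by assumption) (by assumption) (by assumption)]
        split_ifs <;> omega
      · rw [arc_nat (by assumption) (by assumption) (by assumption)]
        split_ifs <;> omega
    · refine ⟨p.1, p.2, q.2, q.1, rfl, Finset.pair_comm _ _, ?_, ?_⟩
      · rw [arc_nat (by assumption) (by assumption) (by assumption)]
        split_ifs <;> omega
      · rw [arc_nat (by assumption) (by assumption) (by assumption)]
        split_ifs <;> omega

lemma inner_range {N : ℕ} {p : ℕ × ℕ} (h : p.2 < N) :
    (inner (Finset.range N) p).card = p.2 - p.1 - 1 := by
  have : inner (Finset.range N) p = Finset.Ioo p.1 p.2 := by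
    ext x; simp only [inner, Finset.mem_filter, Finset.mem_range, Finset.mem_Ioo]; omega
  rw [this, Nat.card_Ioo]

lemma mdiag_iff {m n : ℕ} (hm : 1 ≤ m) (D : Finset (ZMod (m * n + 2))) :
    IsMDiag m n D ↔ ∃ p, Dg m n (Finset.range (m * n + 2)) p ∧ ph (m * n + 2) p = D := by
  constructor
  · rintro ⟨a, b, rfl, hab, -, -, i, hi1, hi2, hi⟩
    have hN : m * i + m ≤ m * n := by
      have := Nat.mul_le_mul_left m (show i + 1 ≤ n by omega); rwa [Nat.mul_add, mul_one] at this
    have va := ZMod.val_lt a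
    have vb := ZMod.val_lt b
    have hv := congrArg ZMod.val hi
    rw [ZMod.val_natCast_of_lt (by omega)] at hv
    have ea : ((a.val : ℕ) : ZMod (m * n + 2)) = a := by simp
    have eb : ((b.val : ℕ) : ZMod (m * n + 2)) = b := by simp
    have hv2 := valsub vb va
    rw [ea, eb, hv] at hv2
    split_ifs at hv2 with hle
    · refine ⟨(a.val, b.val), ⟨by simpa using va, by simpa using vb, ?_, i, hi1, by omega, ?_⟩, ?_⟩
      · simp only; omega
      · rw [inner_range vb]; simp only; omega
      · simp only [ph, ea, eb]
    · refine ⟨(b.val, a.val), ⟨by simpa using vb, by simpa using va, ?_, n - i, by omega,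
        by omega, ?_⟩, ?_⟩
      · simp only; omega
      · rw [inner_range va, Nat.mul_sub]; simp only; omega
      · simp only [ph, ea, eb]; exact Finset.pair_comm _ _
  · rintro ⟨⟨a, b⟩, ⟨h1, h2, h3, i, hi0, hin, hc⟩, rfl⟩
    simp only [Finset.mem_range] at h1 h2 h3
    rw [inner_range h2] at hc
    simp only at hc
    have hN : m * i + m ≤ m * n := by
      have := Nat.mul_le_mul_left m (show i + 1 ≤ n by omega); rwa [Nat.mul_add, mul_one] at this
    have hmi : m * 1 ≤ m * i := Nat.mul_le_mul_left m hi0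
    haveI : Fact (1 < m * n + 2) := ⟨by omega⟩
    refine ⟨a, b, rfl, ?_, ?_, ?_, i, hi0, by omega, ?_⟩
    · intro h; have := cast_inj h1 h2 h; omega
    · intro h
      have := congrArg ZMod.val h
      rw [valsub h2 h1, ZMod.val_one] at this
      split_ifs at this <;> omega
    · intro h
      have := congrArg ZMod.val h
      rw [valsub h1 h2, ZMod.val_one] at this
      split_ifs at this <;> omega
    · rw [← Nat.cast_sub h3.le]; congr 1; omega

def CZ (m n : ℕ) (S : Finset (Finset (ZMod (m * n + 2)))) : Set (Finset (ZMod (m * n + 2))) :=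
  {D | IsMDiag m n D ∧ D ∉ S ∧ ∀ E ∈ S, ¬ Crosses D E}

lemma crosses_symm {m n : ℕ} (hm : 1 ≤ m) {D E : Finset (ZMod (m * n + 2))}
    (hD : IsMDiag m n D) (hE : IsMDiag m n E) (h : Crosses D E) : Crosses E D := by
  obtain ⟨p, hp, rfl⟩ := (mdiag_iff hm D).1 hD
  obtain ⟨q, hq, rfl⟩ := (mdiag_iff hm E).1 hE
  have a1 := Finset.mem_range.1 hp.2.1
  have a2 := Finset.mem_range.1 hq.2.1
  rw [cr_iff hp.2.2.1 a1 hq.2.2.1 a2] at h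
  rw [cr_iff hq.2.2.1 a2 hp.2.2.1 a1]
  exact Cr_symm h

theorem mainZ {m n : ℕ} (hm : 1 ≤ m) (hn : 2 ≤ n) (S : Finset (Finset (ZMod (m * n + 2))))
    (hS : NonCrossingMDiags m n S) :
    S.card + 1 ≤ n ∧ (S.card + 2 = n → (CZ m n S).ncard = m + 1) ∧
    (S.card + 1 < n → (CZ m n S).Nonempty) := by
  classical
  set R := Finset.range (m * n + 2) with hR
  let T : Finset (ℕ × ℕ) := (R ×ˢ R).filter (fun p => Dg m n R p ∧ ph (m * n + 2) p ∈ S)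
  have memT : ∀ p, p ∈ T ↔ Dg m n R p ∧ ph (m * n + 2) p ∈ S := by
    intro p
    simp only [T, Finset.mem_filter, Finset.mem_product]
    constructor
    · exact fun h => h.2
    · exact fun h => ⟨⟨h.1.1, h.1.2.1⟩, h⟩
  have lt2 : ∀ p, Dg m n R p → p.2 < (m * n + 2) := fun p hp => Finset.mem_range.1 hp.2.1
  have inj : ∀ p q, Dg m n R p → Dg m n R q → ph (m * n + 2) p = ph (m * n + 2) q → p = q :=
    fun p q hp hq h => ph_inj hp.2.2.1 (lt2 p hp) hq.2.2.1 (lt2 q hq) h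
  have cr : ∀ p q, Dg m n R p → Dg m n R q → (Crosses (ph (m * n + 2) p) (ph (m * n + 2) q) ↔ Cr p q) :=
    fun p q hp hq => cr_iff hp.2.2.1 (lt2 p hp) hq.2.2.1 (lt2 q hq)
  have hST : T.image (ph (m * n + 2)) = S := by
    ext D
    simp only [Finset.mem_image, memT]
    constructor
    · rintro ⟨p, ⟨_, h⟩, rfl⟩; exact h
    · intro h
      obtain ⟨p, hp, rfl⟩ := (mdiag_iff hm D).1 (hS.1 D h)
      exact ⟨p, ⟨hp, h⟩, rfl⟩
  have hc : S.card = T.card := by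
    rw [← hST, Finset.card_image_of_injOn]
    intro p hp q hq h
    exact inj p q ((memT p).1 hp).1 ((memT q).1 hq).1 h
  have hCZ : CZ m n S = ph (m * n + 2) '' Cpt m n R T := by
    ext D
    constructor
    · rintro ⟨hD, hDS, hcr⟩
      obtain ⟨p, hp, rfl⟩ := (mdiag_iff hm D).1 hD
      refine ⟨p, ⟨hp, fun h => hDS ((memT p).1 h).2, fun q hq => ?_⟩, rfl⟩
      have hq' := (memT q).1 hq
      rw [← cr p q hp hq'.1]
      exact hcr _ hq'.2
    · rintro ⟨p, ⟨hp, hpT, hcr⟩, rfl⟩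
      refine ⟨(mdiag_iff hm _).2 ⟨p, hp, rfl⟩, fun h => hpT ((memT p).2 ⟨hp, h⟩), ?_⟩
      intro E hE
      obtain ⟨q, hq, rfl⟩ := (mdiag_iff hm E).1 (hS.1 E hE)
      have := hcr q ((memT q).2 ⟨hq, hE⟩)
      rwa [← cr p q hp hq] at this
  obtain ⟨r1, r2, r3, r4⟩ := main m hm T.card n R T rfl (by omega) (by simp [hR])
    (fun e he => ((memT e).1 he).1) (by
      intro e he f hf h
      have he' := (memT e).1 he
      have hf' := (memT f).1 hf
      have hne : ph (m * n + 2) e ≠ ph (m * n + 2) f := by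
        intro h'
        have := inj e f he'.1 hf'.1 h'
        subst this
        unfold Cr at h; omega
      exact hS.2 _ he'.2 _ hf'.2 hne ((cr e f he'.1 hf'.1).2 h))
  rw [hc, hCZ]
  refine ⟨r1, fun h => ?_, fun h => (r4 h).image _⟩
  rw [Set.ncard_image_of_injOn, r3 h]
  intro p hp q hq h
  exact inj p q hp.1 hq.1 h

lemma nc_insert {m n : ℕ} (hm : 1 ≤ m) {S : Finset (Finset (ZMod (m * n + 2)))}
    (hS : NonCrossingMDiags m n S) {D} (hD : D ∈ CZ m n S) :
    NonCrossingMDiags m n (insert D S) := by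
  obtain ⟨h1, h2, h3⟩ := hD
  constructor
  · intro E hE
    rcases Finset.mem_insert.1 hE with rfl | hE
    · exact h1
    · exact hS.1 E hE
  · intro E hE F hF hne
    rcases Finset.mem_insert.1 hE with hE' | hE'
    · rcases Finset.mem_insert.1 hF with hF' | hF'
      · exact absurd (hE'.trans hF'.symm) hne
      · rw [hE']; exact h3 F hF'
    · rcases Finset.mem_insert.1 hF with hF' | hF'
      · rw [hF']; exact fun h => h3 E hE' (crosses_symm hm (hS.1 E hE') h1 h)
      · exact hS.2 E hE' F hF' hne

lemma nc_sub {m n : ℕ} {S S' : Finset (Finset (ZMod (m * n + 2)))}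
    (hS : NonCrossingMDiags m n S) (h : S' ⊆ S) : NonCrossingMDiags m n S' :=
  ⟨fun D hD => hS.1 D (h hD), fun D hD E hE => hS.2 D (h hD) E (h hE)⟩

lemma cz_of_insert {m n : ℕ} {S : Finset (Finset (ZMod (m * n + 2)))} {D}
    (h : NonCrossingMDiags m n (insert D S)) (hD : D ∉ S) : D ∈ CZ m n S :=
  ⟨h.1 D (Finset.mem_insert_self _ _), hD, fun E hE =>
    h.2 D (Finset.mem_insert_self _ _) E (Finset.mem_insert_of_mem hE)
      (fun e => hD (e ▸ hE))⟩

lemma ang_iff {m n : ℕ} (hm : 1 ≤ m) (hn : 2 ≤ n) (S : Finset (Finset (ZMod (m * n + 2)))) :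
    IsAngulation m n S ↔ NonCrossingMDiags m n S ∧ S.card + 1 = n := by
  constructor
  · rintro ⟨h1, h2⟩
    refine ⟨h1, ?_⟩
    obtain ⟨a, -, c⟩ := mainZ hm hn S h1
    by_contra h
    obtain ⟨D, hD⟩ := c (by omega)
    have := h2 _ (nc_insert hm h1 hD) (Finset.subset_insert _ _)
    exact hD.2.1 (this ▸ Finset.mem_insert_self D S)
  · rintro ⟨h1, h2⟩
    refine ⟨h1, fun S' hS' hsub => ?_⟩
    have := (mainZ hm hn S' hS').1
    exact (Finset.eq_of_subset_of_card_le hsub (by omega)).symm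

end CC

theorem complements_count (m n : ℕ) (hm : 1 ≤ m) (hn : 2 ≤ n)
    (S : Finset (Finset (ZMod (m * n + 2)))) (hS : NonCrossingMDiags m n S)
    (hcard : S.card = n - 2) :
    {Δ : Finset (Finset (ZMod (m * n + 2))) | IsAngulation m n Δ ∧ S ⊆ Δ}.ncard = m + 1 ∧
      ∀ Δ : Finset (Finset (ZMod (m * n + 2))), IsAngulation m n Δ → ∀ D ∈ Δ,
        {D' : Finset (ZMod (m * n + 2)) | D' ≠ D ∧
          IsAngulation m n (insert D' (Δ.erase D))}.ncard = m := by
  constructor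
  · have e : {Δ : Finset (Finset (ZMod (m * n + 2))) | IsAngulation m n Δ ∧ S ⊆ Δ}
        = (fun D => insert D S) '' CC.CZ m n S := by
      ext Δ
      simp only [Set.mem_setOf_eq, Set.mem_image]
      rw [CC.ang_iff hm hn]
      constructor
      · rintro ⟨⟨h1, h2⟩, h3⟩
        have hs : (Δ \ S).card = 1 := by
          rw [Finset.card_sdiff_of_subset h3]; omega
        obtain ⟨D, hD⟩ := Finset.card_eq_one.1 hs
        have hDm : D ∈ Δ \ S := by rw [hD]; exact Finset.mem_singleton_self D
        have hΔ : insert D S = Δ := by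
          rw [Finset.insert_eq, ← hD, Finset.sdiff_union_of_subset h3]
        exact ⟨D, CC.cz_of_insert (hΔ.symm ▸ h1) (Finset.mem_sdiff.1 hDm).2, hΔ⟩
      · rintro ⟨D, hD, rfl⟩
        refine ⟨⟨CC.nc_insert hm hS hD, ?_⟩, Finset.subset_insert _ _⟩
        rw [Finset.card_insert_of_notMem hD.2.1]; omega
    rw [e, Set.ncard_image_of_injOn, (CC.mainZ hm hn S hS).2.1 (by omega)]
    intro D hD E hE h
    have h' : insert D S = insert E S := h
    have : D ∈ insert E S := h' ▸ Finset.mem_insert_self D S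
    rcases Finset.mem_insert.1 this with h | h
    · exact h
    · exact absurd h hD.2.1
  · intro Δ hΔ D hD
    obtain ⟨h1, h2⟩ := (CC.ang_iff hm hn Δ).1 hΔ
    have hnc := CC.nc_sub h1 (Finset.erase_subset D Δ)
    have hc : (Δ.erase D).card + 1 = Δ.card := Finset.card_erase_add_one hD
    have hDC : D ∈ CC.CZ m n (Δ.erase D) := by
      apply CC.cz_of_insert _ (Finset.notMem_erase D Δ)
      rw [Finset.insert_erase hD]; exact h1
    have e : {D' : Finset (ZMod (m * n + 2)) | D' ≠ D ∧
          IsAngulation m n (insert D' (Δ.erase D))} = CC.CZ m n (Δ.erase D) \ {D} := by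
      ext D'
      simp only [Set.mem_setOf_eq, Set.mem_diff, Set.mem_singleton_iff]
      rw [CC.ang_iff hm hn]
      constructor
      · rintro ⟨hne, hn1, hn2⟩
        refine ⟨CC.cz_of_insert hn1 ?_, hne⟩
        intro h
        rw [Finset.insert_eq_of_mem h] at hn2
        omega
      · rintro ⟨hD', hne⟩
        refine ⟨hne, CC.nc_insert hm hnc hD', ?_⟩
        rw [Finset.card_insert_of_notMem hD'.2.1]; omega
    rw [e, Set.ncard_diff_singleton_of_mem hDC, (CC.mainZ hm hn _ hnc).2.1 (by omega)]
    omega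
end

section
/- Fix integers m ≥ 1 and n ≥ 2 and set N = m·n + 2. Any two (m+2)-angulations of the N-gon are connected by a finite sequence of single exchanges: for all (m+2)-angulations Δ and Δ′ there exist (m+2)-angulations Δ = Δ_0, Δ_1, …, Δ_k = Δ′ such that for each 0 ≤ i < k, the intersection Δ_i ∩ Δ_{i+1} has exactly n − 2 elements (i.e., Δ_{i+1} is obtained from Δ_i by removing one m-diagonal and inserting another). -/
namespace AngEx

def Arc (m n : ℕ) (p : ℕ × ℕ) : Prop :=
  ∃ i, 1 ≤ i ∧ i ≤ n ∧ p.2 = p.1 + m * i + 1 ∧ p.2 ≤ m * n + 1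

def Cr (p q : ℕ × ℕ) : Prop :=
  (p.1 < q.1 ∧ q.1 < p.2 ∧ p.2 < q.2) ∨ (q.1 < p.1 ∧ p.1 < q.2 ∧ q.2 < p.2)

def LNC (m n : ℕ) (T : Finset (ℕ × ℕ)) : Prop :=
  (∀ p ∈ T, Arc m n p) ∧ ∀ p ∈ T, ∀ q ∈ T, ¬ Cr p q

def LMax (m n : ℕ) (T : Finset (ℕ × ℕ)) : Prop :=
  LNC m n T ∧ ∀ p, Arc m n p → (∀ q ∈ T, ¬ Cr p q) → p ∈ T

def V (T : Finset (ℕ × ℕ)) (c d x : ℕ) : Prop :=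
  ∀ a b, (a, b) ∈ T → a < x → x < b → a ≤ c ∧ d ≤ b

lemma arc_lt {m n : ℕ} (hm : 1 ≤ m) {a b : ℕ} (h : Arc m n (a, b)) :
    a + 2 ≤ b ∧ b ≤ m * n + 1 := by
  obtain ⟨i, h1, h2, h3, h4⟩ := h
  have : 1 * 1 ≤ m * i := Nat.mul_le_mul hm h1
  simp only at h3 h4
  omega

lemma ncr {m n : ℕ} {T} (hT : LNC m n T) {a b c d : ℕ} (h : (a, b) ∈ T) (h' : (c, d) ∈ T) :
    ¬ (a < c ∧ c < b ∧ b < d) := fun h3 => hT.2 _ h _ h' (Or.inl h3)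

lemma next {m n : ℕ} (hm : 1 ≤ m) {T} (hT : LNC m n T) {c d x : ℕ} (hcd : (c, d) ∈ T)
    (hcx : c ≤ x) (hxd : x < d) (hV : V T c d x) :
    ∃ x', x < x' ∧ x' ≤ d ∧ V T c d x' ∧ (∃ j, x' = x + m * j + 1) ∧ (x = c → x' < d) := by
  classical
  have hl := (arc_lt hm (hT.1 _ hcd)).1
  let P : ℕ → Prop := fun b => b = x + 1 ∨ ((x, b) ∈ T ∧ ¬ (x = c ∧ b = d))
  have hP : P (Nat.findGreatest P d) := Nat.findGreatest_spec (m := x + 1) (by omega) (Or.inl rfl)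
  have hle : Nat.findGreatest P d ≤ d := Nat.findGreatest_le d
  have hge : x + 1 ≤ Nat.findGreatest P d := Nat.le_findGreatest (by omega) (Or.inl rfl)
  have hgr : ∀ b, b ≤ d → P b → b ≤ Nat.findGreatest P d := fun b h1 h2 => Nat.le_findGreatest h1 h2
  generalize Nat.findGreatest P d = y at *
  refine ⟨y, by omega, hle, ?_, ?_, ?_⟩
  · intro a b hab h1 h2
    by_cases hax : a < x
    · exact hV a b hab hax (by omega)
    have hax' : a = x := by
      by_contra hne
      rcases hP with hP | hP
      · omega
      · exact ncr hT hP.1 hab ⟨by omega, h1, h2⟩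
    subst hax'
    by_cases hb : b ≤ d
    · by_cases hc : a = c ∧ b = d
      · omega
      · have := hgr b hb (Or.inr ⟨hab, hc⟩); omega
    · have := ncr hT hcd hab; omega
  · rcases hP with hP | hP
    · exact ⟨0, by simpa using hP⟩
    · obtain ⟨i, _, _, h, _⟩ := hT.1 _ hP.1
      exact ⟨i, h⟩
  · intro hxc
    rcases hP with hP | hP
    · omega
    · have := hP.2; omega

lemma exists_res {m n : ℕ} (hm : 1 ≤ m) {T} (hT : LNC m n T) {c d : ℕ} (hcd : (c, d) ∈ T)
    (k : ℕ) (hk : 1 ≤ k) (hkm : k ≤ m) :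
    ∃ x, c < x ∧ x < d ∧ V T c d x ∧ ∃ j, x = c + m * j + k := by
  have hl := (arc_lt hm (hT.1 _ hcd)).1
  induction k, hk using Nat.le_induction with
  | base =>
    obtain ⟨x, h1, h2, h3, ⟨j, hj⟩, h5⟩ := next hm hT hcd le_rfl (by omega) (by
      intro a b hab h1 h2
      have := ncr hT hab hcd; omega)
    exact ⟨x, h1, h5 rfl, h3, j, hj⟩
  | succ k hk ih =>
    obtain ⟨x, h1, h2, h3, j, hj⟩ := ih (by omega)
    obtain ⟨y, g1, g2, g3, ⟨l, hl⟩, g5⟩ := next hm hT hcd h1.le h2 h3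
    refine ⟨y, by omega, ?_, g3, j + l, by rw [hl, hj]; ring⟩
    refine lt_of_le_of_ne g2 fun hyd => ?_
    obtain ⟨i, _, _, h, _⟩ := hT.1 _ hcd
    simp only at h
    have h6 : m * i = m * (j + l) + k := by rw [mul_add]; omega
    have h7 : m ∣ k := (Nat.dvd_add_right (Dvd.intro _ rfl)).1 (h6 ▸ Dvd.intro _ rfl)
    have := Nat.le_of_dvd (by omega) h7
    omega

lemma card_le {m n : ℕ} (hm : 1 ≤ m) {T} (hT : LNC m n T) : T.card ≤ n := by
  classical
  have key : ∀ q : (ℕ × ℕ) × ℕ, ∃ x, q ∈ T ×ˢ Finset.Icc 1 m →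
      q.1.1 < x ∧ x < q.1.2 ∧ V T q.1.1 q.1.2 x ∧ ∃ j, x = q.1.1 + m * j + q.2 := by
    rintro ⟨⟨c, d⟩, k⟩
    by_cases h : (c, d) ∈ T ∧ 1 ≤ k ∧ k ≤ m
    · obtain ⟨x, hx⟩ := exists_res hm hT h.1 k h.2.1 h.2.2
      exact ⟨x, fun _ => hx⟩
    · exact ⟨0, fun h' => absurd (by simpa using h') h⟩
  choose g hg using key
  have h := Finset.card_le_card_of_injOn (s := T ×ˢ Finset.Icc 1 m) (t := Finset.Icc 1 (m * n)) g
    (by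
      intro q hq
      have h1 := hg q hq
      have hq1 : q.1 ∈ T := (Finset.mem_product.1 hq).1
      have h2 := arc_lt (a := q.1.1) (b := q.1.2) hm (hT.1 _ hq1)
      obtain ⟨h3, h4, -, -⟩ := h1
      simp only [Finset.coe_Icc, Set.mem_Icc]
      omega)
    (by
      rintro ⟨⟨c, d⟩, k⟩ hq ⟨⟨c', d'⟩, k'⟩ hq' he
      have hq := Finset.mem_coe.1 hq
      have hq' := Finset.mem_coe.1 hq'
      obtain ⟨a1, a2, a3, j, a4⟩ := hg _ hq
      obtain ⟨b1, b2, b3, j', b4⟩ := hg _ hq'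
      rw [← he] at b1 b2 b3 b4
      simp only [Finset.mem_product, Finset.mem_Icc] at hq hq' a1 a2 a3 a4 b1 b2 b3 b4
      have e1 := a3 c' d' hq'.1 b1 b2
      have e2 := b3 c d hq.1 a1 a2
      have e3 : c = c' := by omega
      have e4 : d = d' := by omega
      have e5 : k = k' := by
        have : m * j + k = m * j' + k' := by omega
        have h5 : (k : ℤ) - k' = m * ((j' : ℤ) - j) := by
          have : (m * j + k : ℤ) = m * j' + k' := by exact_mod_cast this
          linarith
        have h6 : (k : ℤ) - k' = 0 := Int.eq_zero_of_abs_lt_dvd (m := m) (Dvd.intro _ h5.symm)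
          (by rw [abs_lt]; omega)
        omega
      rw [e3, e4, e5])
  rw [Finset.card_product, Nat.card_Icc, Nat.card_Icc] at h
  simp only [Nat.add_sub_cancel] at h
  rw [mul_comm] at h
  exact Nat.le_of_mul_le_mul_left h hm

lemma root_arc {m n : ℕ} (hn : 1 ≤ n) : Arc m n (0, m * n + 1) :=
  ⟨n, hn, le_rfl, by simp, le_rfl⟩

lemma root_ncr {m n : ℕ} {p} (h : Arc m n p) : ¬ Cr p (0, m * n + 1) ∧ ¬ Cr (0, m * n + 1) p := by
  obtain ⟨i, _, _, h3, h4⟩ := h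
  simp only [Cr]; omega

lemma root_mem {m n : ℕ} (hn : 1 ≤ n) {T} (hT : LMax m n T) : (0, m * n + 1) ∈ T :=
  hT.2 _ (root_arc hn) fun q hq => (root_ncr (hT.1.1 q hq)).2

lemma card_ge {m n : ℕ} (hm : 1 ≤ m) (hn : 1 ≤ n) {T} (hT : LMax m n T) : n ≤ T.card := by
  classical
  have key : ∀ x : ℕ, ∃ p : ℕ × ℕ, x ∈ Finset.Icc 1 (m * n) →
      p ∈ T ∧ p.1 < x ∧ x < p.2 ∧ V T p.1 p.2 x := by
    intro x
    by_cases hx : x ∈ Finset.Icc 1 (m * n)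
    swap
    · exact ⟨(0, 0), fun h => absurd h hx⟩
    have hx' := Finset.mem_Icc.1 hx
    obtain ⟨p, hp, hmin⟩ := Finset.exists_min_image (T.filter fun p => p.1 < x ∧ x < p.2)
      (fun p => p.2 - p.1) ⟨(0, m * n + 1), by
        simp only [Finset.mem_filter]
        exact ⟨root_mem hn hT, by omega, by omega⟩⟩
    simp only [Finset.mem_filter] at hp hmin
    refine ⟨p, fun _ => ⟨hp.1, hp.2.1, hp.2.2, ?_⟩⟩
    intro a b hab h1 h2
    have h3 := hmin (a, b) ⟨hab, h1, h2⟩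
    have h4 := ncr hT.1 hab hp.1
    have h5 := ncr hT.1 hp.1 hab
    simp only at h3
    omega
  choose g hg using key
  have aux : ∀ x y, x ∈ Finset.Icc 1 (m * n) → y ∈ Finset.Icc 1 (m * n) → g x = g y →
      x % m = y % m → ¬ x < y := by
    intro x y hx hy he hr hlt
    obtain ⟨a0, a1, a2, a3⟩ := hg x hx
    obtain ⟨b0, b1, b2, b3⟩ := hg y hy
    rw [← he] at b0 b1 b2 b3
    generalize g x = p at *
    obtain ⟨c, d⟩ := p
    simp only at *
    obtain ⟨z, g1, g2, g3, ⟨j, hj⟩, g5⟩ := next hm hT.1 a0 b1.le b2 b3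
    obtain ⟨t, ht⟩ := (Nat.modEq_iff_dvd' hlt.le).1 hr
    have ht1 : 1 ≤ t := by
      rcases Nat.eq_zero_or_pos t with h | h
      · subst h; omega
      · exact h
    have hz : z = x + m * (t + j) + 1 := by rw [mul_add]; omega
    have hd := (arc_lt hm (hT.1.1 _ a0)).2
    have hin : (x, z) ∈ T := by
      refine hT.2 _ ⟨t + j, by omega, ?_, hz, by simp only; omega⟩ ?_
      · have : m * (t + j) ≤ m * n := by omega
        exact Nat.le_of_mul_le_mul_left this hm
      · rintro ⟨a, b⟩ hab (h | h)
        · have := g3 a b hab h.2.1 h.2.2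
          simp only at h; omega
        · have := a3 a b hab h.1 h.2.1
          simp only at h; omega
    have := b3 x z hin hlt g1
    omega
  have h := Finset.card_le_card_of_injOn (s := Finset.Icc 1 (m * n)) (t := T ×ˢ Finset.range m)
    (fun x => (g x, x % m))
    (by
      intro x hx
      simp only [Finset.coe_product, Set.mem_prod, Finset.mem_coe, Finset.mem_range]
      exact ⟨(hg x hx).1, Nat.mod_lt _ hm⟩)
    (by
      intro x hx y hy he
      simp only [Prod.mk.injEq] at he
      have h1 := aux x y hx hy he.1 he.2
      have h2 := aux y x hy hx he.1.symm he.2.symm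
      omega)
  rw [Finset.card_product, Nat.card_Icc, Finset.card_range] at h
  simp only [Nat.add_sub_cancel] at h
  rw [mul_comm T.card] at h
  exact Nat.le_of_mul_le_mul_left h hm

lemma cr_symm {p q} (h : Cr p q) : Cr q p := by
  simp only [Cr] at *; omega

lemma lmax_of_card {m n : ℕ} (hm : 1 ≤ m) {T} (hT : LNC m n T) (hc : T.card = n) : LMax m n T := by
  classical
  refine ⟨hT, fun p hp hq => ?_⟩
  by_contra hpT
  have : LNC m n (insert p T) := by
    refine ⟨fun q h => ?_, fun q h r h' => ?_⟩
    · rcases Finset.mem_insert.1 h with rfl | h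
      · exact hp
      · exact hT.1 q h
    · rcases Finset.mem_insert.1 h with rfl | h <;> rcases Finset.mem_insert.1 h' with rfl | h'
      · simp only [Cr]; omega
      · exact hq r h'
      · exact fun h2 => hq q (by assumption) (cr_symm h2)
      · exact hT.2 q h r h'
  have := card_le hm this
  rw [Finset.card_insert_of_notMem hpT] at this
  omega

def Step (m n : ℕ) (T T' : Finset (ℕ × ℕ)) : Prop :=
  LMax m n T ∧ LMax m n T' ∧ (T ∩ T').card = n - 1

lemma flip {m n : ℕ} (hm : 1 ≤ m) (hn : 1 ≤ n) {T} (hT : LMax m n T)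
    (h : ∃ p ∈ T, 0 < p.1) : ∃ T', Step m n T T' ∧
      (T'.filter fun p => 0 < p.1).card < (T.filter fun p => 0 < p.1).card := by
  classical
  obtain ⟨p0, hp0, hp0'⟩ := h
  obtain ⟨⟨c, d⟩, hp, hmax⟩ := Finset.exists_max_image (T.filter fun p => 0 < p.1)
    (fun p => p.2 - p.1) ⟨p0, by simp [hp0, hp0']⟩
  simp only [Finset.mem_filter] at hp hmax
  obtain ⟨hcd, hc⟩ := hp
  have hd := arc_lt hm (hT.1.1 _ hcd)
  have hdm := Nat.div_add_mod (c - 1) m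
  have hlt := Nat.mod_lt (c - 1) (show 0 < m from hm)
  obtain ⟨x, h1, h2, h3, j, hj⟩ := exists_res hm hT.1 hcd (m - (c - 1) % m) (by omega) (by omega)
  have hx : x = m * ((c - 1) / m + 1 + j) + 1 := by
    rw [mul_add, mul_add]; omega
  have hxa : Arc m n (0, x) := by
    refine ⟨(c - 1) / m + 1 + j, Nat.le_add_right_of_le (Nat.le_add_left _ _), ?_, by simp only; omega, by simp only; omega⟩
    have : m * ((c - 1) / m + 1 + j) ≤ m * n := by omega
    exact Nat.le_of_mul_le_mul_left this hm
  have hxT : (0, x) ∉ T := fun h => ncr hT.1 h hcd ⟨hc, h1, h2⟩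
  have hcr : ∀ q ∈ T, q ≠ (c, d) → ¬ Cr (0, x) q := by
    rintro ⟨a, b⟩ hab hne hC
    have hC : 0 < a ∧ a < x ∧ x < b := by simp only [Cr] at hC; omega
    have h4 := h3 a b hab hC.2.1 hC.2.2
    have h5 := hmax (a, b) ⟨hab, hC.1⟩
    simp only at h5
    exact hne (by ext <;> simp only <;> omega)
  have hcard : T.card = n := le_antisymm (card_le hm hT.1) (card_ge hm hn hT)
  have hn1 : (0, x) ∉ T.erase (c, d) := fun h => hxT (Finset.mem_of_mem_erase h)
  have hce : (T.erase (c, d)).card = n - 1 := by rw [Finset.card_erase_of_mem hcd, hcard]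
  refine ⟨insert (0, x) (T.erase (c, d)), ⟨hT, lmax_of_card hm ⟨?_, ?_⟩ ?_, ?_⟩, ?_⟩
  · intro q h
    rcases Finset.mem_insert.1 h with rfl | h
    · exact hxa
    · exact hT.1.1 q (Finset.mem_of_mem_erase h)
  · intro q h r h'
    rcases Finset.mem_insert.1 h with rfl | h <;> rcases Finset.mem_insert.1 h' with rfl | h'
    · simp only [Cr]; omega
    · exact hcr r (Finset.mem_of_mem_erase h') (Finset.ne_of_mem_erase h')
    · exact fun h2 => hcr q (Finset.mem_of_mem_erase h) (Finset.ne_of_mem_erase h) (cr_symm h2)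
    · exact hT.1.2 q (Finset.mem_of_mem_erase h) r (Finset.mem_of_mem_erase h')
  · rw [Finset.card_insert_of_notMem hn1, hce]; omega
  · rw [Finset.inter_insert_of_notMem hxT, Finset.inter_eq_right.2 (Finset.erase_subset _ _), hce]
  · apply Finset.card_lt_card
    rw [Finset.filter_insert, if_neg (by simp), Finset.ssubset_iff_of_subset
      (Finset.filter_subset_filter _ (Finset.erase_subset _ _))]
    exact ⟨(c, d), by simp [hcd, hc], by simp⟩

def Fan (m n : ℕ) : Finset (ℕ × ℕ) := (Finset.Icc 1 n).image fun i => (0, m * i + 1)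

lemma fan_lnc (m n : ℕ) : LNC m n (Fan m n) := by
  simp only [Fan]
  refine ⟨fun p hp => ?_, fun p hp q hq => ?_⟩
  · obtain ⟨i, hi, rfl⟩ := Finset.mem_image.1 hp
    have hi := Finset.mem_Icc.1 hi
    have := Nat.mul_le_mul_left m hi.2
    exact ⟨i, hi.1, hi.2, by simp, by simp only; omega⟩
  · obtain ⟨i, hi, rfl⟩ := Finset.mem_image.1 hp
    obtain ⟨j, hj, rfl⟩ := Finset.mem_image.1 hq
    simp only [Cr]; omega

lemma to_fan {m n : ℕ} (hm : 1 ≤ m) (hn : 1 ≤ n) (k : ℕ) : ∀ T, LMax m n T →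
    (T.filter fun p => 0 < p.1).card = k → Relation.ReflTransGen (Step m n) T (Fan m n) := by
  induction k using Nat.strong_induction_on with
  | _ k ih =>
    intro T hT hk
    by_cases h : ∃ p ∈ T, 0 < p.1
    · obtain ⟨T', h1, h2⟩ := flip hm hn hT h
      exact Relation.ReflTransGen.head h1 (ih _ (hk ▸ h2) T' h1.2.1 rfl)
    · have : T = Fan m n := by
        push Not at h
        apply Finset.Subset.antisymm
        · intro p hp
          obtain ⟨i, h1, h2, h3, h4⟩ := hT.1.1 p hp
          have := h p hp
          refine Finset.mem_image.2 ⟨i, Finset.mem_Icc.2 ⟨h1, h2⟩, ?_⟩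
          ext <;> simp only <;> omega
        · intro p hp
          refine hT.2 p ((fan_lnc m n).1 p hp) fun q hq => ?_
          have := h q hq
          obtain ⟨i, hi, rfl⟩ := Finset.mem_image.1 hp
          simp only [Cr]; omega
      rw [this]

lemma step_symm (m n : ℕ) : Std.Symm (Step m n) := ⟨fun T T' h =>
  ⟨h.2.1, h.1, by rw [Finset.inter_comm]; exact h.2.2⟩⟩

lemma lin_conn {m n : ℕ} (hm : 1 ≤ m) (hn : 1 ≤ n) {T T'} (hT : LMax m n T) (hT' : LMax m n T') :
    Relation.ReflTransGen (Step m n) T T' :=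
  haveI := step_symm m n
  (to_fan hm hn _ T hT rfl).trans
    (Std.Symm.symm (r := Relation.ReflTransGen (Step m n)) _ _ (to_fan hm hn _ T' hT' rfl))

/-! Translation to the cyclic setting. -/

lemma val_sub' {N : ℕ} [NeZero N] (a b : ZMod N) :
    (b - a).val = if a.val ≤ b.val then b.val - a.val else N + b.val - a.val := by
  have ha := ZMod.val_lt a
  have hb := ZMod.val_lt b
  split_ifs with h
  · exact ZMod.val_sub h
  · have : b - a = ((N + b.val - a.val : ℕ) : ZMod N) := by
      rw [Nat.cast_sub (by omega)]; simp
    rw [this, ZMod.val_cast_of_lt (by omega)]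

lemma arc_iff {N : ℕ} [NeZero N] (a b x : ZMod N) : InOpenArc a b x ↔
    (a.val < x.val ∧ x.val < b.val) ∨ (b.val < a.val ∧ (a.val < x.val ∨ x.val < b.val)) := by
  have ha := ZMod.val_lt a
  have hb := ZMod.val_lt b
  have hx := ZMod.val_lt x
  have h1 : InOpenArc a b x ↔ 0 < (x - a).val ∧ (x - a).val < (b - a).val := by
    constructor
    · rintro ⟨k, h1, h2, rfl⟩
      have := ZMod.val_lt (b - a)
      rw [add_sub_cancel_left, ZMod.val_cast_of_lt (by omega)]
      exact ⟨h1, h2⟩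
    · intro h
      exact ⟨(x - a).val, h.1, h.2, by simp⟩
  rw [h1, val_sub', val_sub']
  split_ifs <;> omega

def phi (N : ℕ) (p : ℕ × ℕ) : Finset (ZMod N) := {(p.1 : ZMod N), (p.2 : ZMod N)}

lemma pair_cases {α : Type*} [DecidableEq α] {a b c d : α} (h : ({a, b} : Finset α) = {c, d}) :
    (a = c ∧ b = d) ∨ (a = d ∧ b = c) := by
  have h' : s(a, b) = s(c, d) := by
    have := congrArg (fun s : Finset α => (s : Set α)) h
    simp only [Finset.coe_insert, Finset.coe_singleton] at this
    exact Sym2.eq_iff.2 (Set.pair_eq_pair_iff.1 this)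
  exact Sym2.eq_iff.1 h'

lemma phi_inj {N : ℕ} {p q : ℕ × ℕ} (hp : p.1 < p.2) (hp' : p.2 < N) (hq : q.1 < q.2)
    (hq' : q.2 < N) (h : phi N p = phi N q) : p = q := by
  have v : ∀ a < N, ((a : ℕ) : ZMod N).val = a := fun a h => ZMod.val_cast_of_lt h
  rcases pair_cases h with ⟨h1, h2⟩ | ⟨h1, h2⟩ <;>
  · have h1 := congrArg ZMod.val h1
    have h2 := congrArg ZMod.val h2
    rw [v _ (by omega), v _ (by omega)] at h1 h2
    ext <;> omega

lemma crosses_iff {N : ℕ} {p q : ℕ × ℕ} (hp : p.1 < p.2) (hp' : p.2 < N) (hq : q.1 < q.2)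
    (hq' : q.2 < N) : Crosses (phi N p) (phi N q) ↔ Cr p q := by
  have : NeZero N := ⟨by omega⟩
  have v : ∀ a < N, ((a : ℕ) : ZMod N).val = a := fun a h => ZMod.val_cast_of_lt h
  have v1 := v p.1 (by omega)
  have v2 := v p.2 (by omega)
  have v3 := v q.1 (by omega)
  have v4 := v q.2 (by omega)
  constructor
  · rintro ⟨a, b, c, d, h1, h2, h3, h4⟩
    rw [arc_iff] at h3 h4
    simp only [Cr]
    rcases pair_cases h1 with ⟨rfl, rfl⟩ | ⟨rfl, rfl⟩ <;>
    rcases pair_cases h2 with ⟨rfl, rfl⟩ | ⟨rfl, rfl⟩ <;>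
    · rw [v1, v2, v3, v4] at *
      omega
  · rintro (h | h)
    · refine ⟨p.1, p.2, q.1, q.2, rfl, rfl, ?_, ?_⟩ <;> rw [arc_iff, v1, v2] <;>
        simp only [v3, v4] <;> omega
    · refine ⟨p.1, p.2, q.2, q.1, rfl, Finset.pair_comm _ _, ?_, ?_⟩ <;> rw [arc_iff, v1, v2] <;>
        simp only [v3, v4] <;> omega

lemma arc_bd {m n : ℕ} {p} (h : Arc m n p) : p.1 < p.2 ∧ p.2 < m * n + 2 := by
  obtain ⟨i, h1, h2, h3, h4⟩ := h
  omega

lemma mdiag_phi {m n : ℕ} (hm : 1 ≤ m) (hn : 2 ≤ n) {p} (hp : Arc m n p)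
    (hr : p ≠ (0, m * n + 1)) : IsMDiag m n (phi (m * n + 2) p) := by
  have hb := arc_bd hp
  obtain ⟨i, h1, h2, h3, h4⟩ := hp
  have hi : i ≠ n := by
    rintro rfl
    exact hr (by ext <;> simp only <;> omega)
  have hlt : m * (i + 1) ≤ m * n := Nat.mul_le_mul_left m (by omega)
  have hge : m * 1 ≤ m * i := Nat.mul_le_mul_left m h1
  rw [mul_add] at hlt
  have v : ∀ a < m * n + 2, ((a : ℕ) : ZMod (m * n + 2)).val = a := fun a h => ZMod.val_cast_of_lt h
  have v1 := v p.1 (by omega)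
  have v2 := v p.2 (by omega)
  have vone : (1 : ZMod (m * n + 2)).val = 1 := by
    have := v 1 (by omega)
    simpa using this
  have d1 := val_sub' (p.1 : ZMod (m * n + 2)) p.2
  have d2 := val_sub' (p.2 : ZMod (m * n + 2)) p.1
  rw [v1, v2] at d1 d2
  rw [if_pos (by omega)] at d1
  rw [if_neg (by omega)] at d2
  refine ⟨p.1, p.2, rfl, ?_, ?_, ?_, i, h1, by omega, ?_⟩
  · intro h
    have := congrArg ZMod.val h
    omega
  · intro h
    have := congrArg ZMod.val h
    omega
  · intro h
    have := congrArg ZMod.val h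
    omega
  · rw [h3]; push_cast; ring

lemma mdiag_exists {m n : ℕ} (hm : 1 ≤ m) (hn : 2 ≤ n) {D} (hD : IsMDiag m n D) :
    ∃ p, Arc m n p ∧ p ≠ (0, m * n + 1) ∧ D = phi (m * n + 2) p := by
  obtain ⟨a, b, rfl, hab, -, -, i, h1, h2, h3⟩ := hD
  have hlt : m * (i + 1) ≤ m * n := Nat.mul_le_mul_left m (by omega)
  rw [mul_add] at hlt
  have h4 := congrArg ZMod.val h3
  rw [ZMod.val_cast_of_lt (by omega), val_sub'] at h4
  have ha := ZMod.val_lt a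
  have hb := ZMod.val_lt b
  split_ifs at h4 with h
  · refine ⟨(a.val, b.val), ⟨i, h1, by omega, by simp only; omega, by simp only; omega⟩, ?_, ?_⟩
    · intro h; simp only [Prod.mk.injEq] at h; omega
    · simp [phi]
  · have hs : m * (n - i) = m * n - m * i := Nat.mul_sub _ _ _
    have hge : m * 1 ≤ m * i := Nat.mul_le_mul_left m h1
    refine ⟨(b.val, a.val), ⟨n - i, by omega, by omega, by simp only; omega, by simp only; omega⟩,
      ?_, ?_⟩
    · intro h; simp only [Prod.mk.injEq] at h; omega
    · simp [phi, Finset.pair_comm]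

def Psi (m n : ℕ) (T : Finset (ℕ × ℕ)) : Finset (Finset (ZMod (m * n + 2))) :=
  (T.erase (0, m * n + 1)).image (phi (m * n + 2))

lemma crosses_iff' {m n : ℕ} {p q} (hp : Arc m n p) (hq : Arc m n q) :
    Crosses (phi (m * n + 2) p) (phi (m * n + 2) q) ↔ Cr p q :=
  crosses_iff (arc_bd hp).1 (arc_bd hp).2 (arc_bd hq).1 (arc_bd hq).2

lemma phi_inj' {m n : ℕ} {p q} (hp : Arc m n p) (hq : Arc m n q)
    (h : phi (m * n + 2) p = phi (m * n + 2) q) : p = q :=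
  phi_inj (arc_bd hp).1 (arc_bd hp).2 (arc_bd hq).1 (arc_bd hq).2 h

lemma psi_ang {m n : ℕ} (hm : 1 ≤ m) (hn : 2 ≤ n) {T} (hT : LMax m n T) :
    IsAngulation m n (Psi m n T) := by
  refine ⟨⟨?_, ?_⟩, ?_⟩
  · intro D hD
    obtain ⟨p, hp, rfl⟩ := Finset.mem_image.1 hD
    have hp := Finset.mem_erase.1 hp
    exact mdiag_phi hm hn (hT.1.1 p hp.2) hp.1
  · intro D hD E hE _
    obtain ⟨p, hp, rfl⟩ := Finset.mem_image.1 hD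
    obtain ⟨q, hq, rfl⟩ := Finset.mem_image.1 hE
    have hp := Finset.mem_erase.1 hp
    have hq := Finset.mem_erase.1 hq
    rw [crosses_iff' (hT.1.1 p hp.2) (hT.1.1 q hq.2)]
    exact hT.1.2 p hp.2 q hq.2
  · intro S' hS' hsub
    refine Finset.Subset.antisymm (fun D hD => ?_) hsub
    obtain ⟨p, hp, hr, rfl⟩ := mdiag_exists hm hn (hS'.1 D hD)
    refine Finset.mem_image.2 ⟨p, Finset.mem_erase.2 ⟨hr, hT.2 p hp fun q hq => ?_⟩, rfl⟩
    by_cases hqr : q = (0, m * n + 1)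
    · rw [hqr]; exact (root_ncr hp).1
    by_cases hpq : p = q
    · subst hpq; simp only [Cr]; omega
    have hqa := hT.1.1 q hq
    rw [← crosses_iff' hp hqa]
    refine hS'.2 _ hD _ (hsub (Finset.mem_image.2 ⟨q, Finset.mem_erase.2 ⟨hqr, hq⟩, rfl⟩))
      fun h => hpq (phi_inj' hp hqa h)

lemma exists_psi {m n : ℕ} (hm : 1 ≤ m) (hn : 2 ≤ n) {S} (hS : IsAngulation m n S) :
    ∃ T, LMax m n T ∧ Psi m n T = S := by
  classical
  let T : Finset (ℕ × ℕ) := (Finset.range (m * n + 2) ×ˢ Finset.range (m * n + 2)).filter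
    fun p => Arc m n p ∧ (p = (0, m * n + 1) ∨ phi (m * n + 2) p ∈ S)
  have hmem : ∀ p, p ∈ T ↔ Arc m n p ∧ (p = (0, m * n + 1) ∨ phi (m * n + 2) p ∈ S) := by
    intro p
    simp only [T, Finset.mem_filter, Finset.mem_product, Finset.mem_range, and_iff_right_iff_imp]
    intro h
    have := arc_bd h.1
    omega
  have hself : ∀ p, ¬ Cr p p := by intro p; simp only [Cr]; omega
  refine ⟨T, ⟨⟨fun p hp => ((hmem p).1 hp).1, ?_⟩, ?_⟩, ?_⟩
  · intro p hp q hq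
    obtain ⟨pa, hp⟩ := (hmem p).1 hp
    obtain ⟨qa, hq⟩ := (hmem q).1 hq
    rcases hp with rfl | hp
    · exact (root_ncr qa).2
    rcases hq with rfl | hq
    · exact (root_ncr pa).1
    by_cases hpq : p = q
    · subst hpq; exact hself p
    rw [← crosses_iff' pa qa]
    exact hS.1.2 _ hp _ hq fun h => hpq (phi_inj' pa qa h)
  · intro p hp hq
    refine (hmem p).2 ⟨hp, ?_⟩
    by_cases hr : p = (0, m * n + 1)
    · exact Or.inl hr
    refine Or.inr ?_
    have key : ∀ E ∈ S, ¬ Crosses (phi (m * n + 2) p) E ∧ ¬ Crosses E (phi (m * n + 2) p) := by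
      intro E hE
      obtain ⟨q, qa, -, rfl⟩ := mdiag_exists hm hn (hS.1.1 E hE)
      rw [crosses_iff' hp qa, crosses_iff' qa hp]
      have := hq q ((hmem q).2 ⟨qa, Or.inr hE⟩)
      exact ⟨this, fun h => this (cr_symm h)⟩
    have := hS.2 (insert (phi (m * n + 2) p) S) ⟨?_, ?_⟩ (Finset.subset_insert _ _)
    · rw [← this]; exact Finset.mem_insert_self _ _
    · intro D hD
      rcases Finset.mem_insert.1 hD with rfl | hD
      · exact mdiag_phi hm hn hp hr
      · exact hS.1.1 D hD
    · intro D hD E hE hne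
      rcases Finset.mem_insert.1 hD with rfl | hD <;> rcases Finset.mem_insert.1 hE with rfl | hE
      · exact absurd rfl hne
      · exact (key E hE).1
      · exact (key D hD).2
      · exact hS.1.2 D hD E hE hne
  · ext D
    simp only [Psi, Finset.mem_image, Finset.mem_erase, hmem]
    constructor
    · rintro ⟨p, ⟨h1, -, h2⟩, rfl⟩
      exact h2.resolve_left h1
    · intro hD
      obtain ⟨p, pa, hr, rfl⟩ := mdiag_exists hm hn (hS.1.1 D hD)
      exact ⟨p, ⟨hr, pa, Or.inr hD⟩, rfl⟩

lemma psi_step {m n : ℕ} (hn : 2 ≤ n) {T T'} (h : Step m n T T') :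
    (Psi m n T ∩ Psi m n T').card = n - 2 := by
  classical
  obtain ⟨hT, hT', hc⟩ := h
  have h1 := root_mem (by omega) hT
  have h2 := root_mem (by omega) hT'
  have : Psi m n T ∩ Psi m n T' = Psi m n (T ∩ T') := by
    ext D
    simp only [Psi, Finset.mem_inter, Finset.mem_image, Finset.mem_erase]
    constructor
    · rintro ⟨⟨p, ⟨p1, p2⟩, rfl⟩, ⟨q, ⟨q1, q2⟩, h⟩⟩
      have := phi_inj' (hT'.1.1 q q2) (hT.1.1 p p2) h
      subst this
      exact ⟨q, ⟨p1, p2, q2⟩, rfl⟩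
    · rintro ⟨p, ⟨p1, p2, p3⟩, rfl⟩
      exact ⟨⟨p, ⟨p1, p2⟩, rfl⟩, ⟨p, ⟨p1, p3⟩, rfl⟩⟩
  rw [this, Psi, Finset.card_image_of_injOn, Finset.card_erase_of_mem (Finset.mem_inter.2 ⟨h1, h2⟩),
    hc]
  · omega
  · intro p hp q hq h
    have hp := (Finset.mem_inter.1 (Finset.mem_of_mem_erase (Finset.mem_coe.1 hp))).1
    have hq := (Finset.mem_inter.1 (Finset.mem_of_mem_erase (Finset.mem_coe.1 hq))).1
    exact phi_inj' (hT.1.1 p hp) (hT.1.1 q hq) h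

lemma conn {m n : ℕ} (hm : 1 ≤ m) (hn : 2 ≤ n) {T T'} (hT : LMax m n T)
    (h : Relation.ReflTransGen (Step m n) T T') :
    ∃ (k : ℕ) (f : ℕ → Finset (Finset (ZMod (m * n + 2)))),
      f 0 = Psi m n T ∧ f k = Psi m n T' ∧ (∀ i ≤ k, IsAngulation m n (f i)) ∧
      ∀ i < k, (f i ∩ f (i + 1)).card = n - 2 := by
  induction h with
  | refl => exact ⟨0, fun _ => Psi m n T, rfl, rfl, fun _ _ => psi_ang hm hn hT, by simp⟩
  | @tail T1 T2 _ hs ih =>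
    obtain ⟨k, f, f0, fk, h1, h2⟩ := ih
    refine ⟨k + 1, fun i => if i ≤ k then f i else Psi m n T2, ?_, ?_, ?_, ?_⟩
    · simp [f0]
    · simp
    · intro i hi
      by_cases h : i ≤ k
      · simp only [h, if_true]; exact h1 i h
      · simp only [h, if_false]; exact psi_ang hm hn hs.2.1
    · intro i hi
      by_cases h : i = k
      · subst h
        simp only [le_refl, if_true, Nat.not_succ_le_self, if_false, fk]
        exact psi_step hn hs
      · simp only [show i ≤ k by omega, show i + 1 ≤ k by omega, if_true]
        exact h2 i (by omega)

end AngEx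

theorem angulations_exchange_connected (m n : ℕ) (hm : 1 ≤ m) (hn : 2 ≤ n)
    (Δ Δ' : Finset (Finset (ZMod (m * n + 2))))
    (hΔ : IsAngulation m n Δ) (hΔ' : IsAngulation m n Δ') :
    ∃ (k : ℕ) (f : ℕ → Finset (Finset (ZMod (m * n + 2)))),
      f 0 = Δ ∧ f k = Δ' ∧ (∀ i ≤ k, IsAngulation m n (f i)) ∧
      ∀ i < k, (f i ∩ f (i + 1)).card = n - 2 := by
  obtain ⟨T, hT, rfl⟩ := AngEx.exists_psi hm hn hΔ
  obtain ⟨T', hT', rfl⟩ := AngEx.exists_psi hm hn hΔ'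
  exact AngEx.conn hm hn hT (AngEx.lin_conn hm (by omega) hT hT')
end

section
/- Fix integers m ≥ 1 and n ≥ 2 and set N = m·n + 2. The number of m-diagonals of the N-gon equals (n − 1)·(m·n + 2)/2; that is, twice the number of m-diagonals equals (n − 1)·(m·n + 2). (This is the number of isomorphism classes of indecomposable objects in the m-cluster category of type A_{n−1}.) -/
theorem mDiags_count (m n : ℕ) (hm : 1 ≤ m) (hn : 2 ≤ n) :
    2 * {D : Finset (ZMod (m * n + 2)) | IsMDiag m n D}.ncard =
      (n - 1) * (m * n + 2) := by
  classical
  haveI : NeZero (m * n + 2) := ⟨by omega⟩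
  have hlt : ∀ i, i ≤ n - 1 → m * i + 1 < m * n + 2 := fun i hi => by
    have : m * i ≤ m * n := Nat.mul_le_mul_left m (by omega)
    omega
  have hinj : ∀ x y : ℕ, x < m * n + 2 → y < m * n + 2 →
      (x : ZMod (m * n + 2)) = y → x = y := fun x y hx hy h => by
    rw [ZMod.natCast_eq_natCast_iff', Nat.mod_eq_of_lt hx, Nat.mod_eq_of_lt hy] at h
    exact h
  obtain ⟨c, hc⟩ : ∃ c : ℕ → ZMod (m * n + 2), ∀ i, c i = ((m * i + 1 : ℕ) : ZMod (m * n + 2)) :=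
    ⟨_, fun i => rfl⟩
  have c_inj : ∀ i j, i ≤ n - 1 → j ≤ n - 1 → c i = c j → i = j := fun i j hi hj h => by
    rw [hc, hc] at h
    have := hinj _ _ (hlt i hi) (hlt j hj) h
    exact Nat.eq_of_mul_eq_mul_left hm (by omega)
  have c_ne0 : ∀ i, i ≤ n - 1 → c i ≠ 0 := fun i hi h => by
    rw [hc] at h
    have := hinj _ 0 (hlt i hi) (by omega) (by rw [h]; simp)
    omega
  have c_ne1 : ∀ i, 1 ≤ i → i ≤ n - 1 → c i ≠ 1 := fun i h1 hi h => by
    rw [hc] at h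
    have := hinj _ 1 (hlt i hi) (by omega) (by rw [h]; simp)
    have : 0 < m * i := Nat.mul_pos hm h1
    omega
  have c_neg : ∀ i, i ≤ n - 1 → c i + c (n - i) = 0 := fun i hi => by
    rw [hc, hc, ← Nat.cast_add]
    have : m * i + 1 + (m * (n - i) + 1) = m * n + 2 := by
      obtain ⟨k, rfl⟩ : ∃ k, n = i + k := ⟨n - i, by omega⟩
      rw [Nat.add_sub_cancel_left]; ring
    rw [this, ZMod.natCast_self]
  set P : Finset (ZMod (m * n + 2) × ℕ) := Finset.univ ×ˢ Finset.Icc 1 (n - 1) with hP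
  set f : ZMod (m * n + 2) × ℕ → Finset (ZMod (m * n + 2)) := fun p => {p.1, p.1 + c p.2} with hf
  have hset : {D : Finset (ZMod (m * n + 2)) | IsMDiag m n D} = ↑(P.image f) := by
    ext D
    simp only [Set.mem_ofPred_eq, Finset.coe_image, Set.mem_image, Finset.mem_coe, hP, hf,
      Finset.mem_product, Finset.mem_univ, true_and, Finset.mem_Icc, Prod.exists]
    constructor
    · rintro ⟨a, b, rfl, -, -, -, i, h1, h2, h⟩
      refine ⟨a, i, ⟨h1, h2⟩, ?_⟩
      rw [hc, ← h]; congr 2; ring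
    · rintro ⟨a, i, ⟨h1, h2⟩, rfl⟩
      refine ⟨a, a + c i, rfl, ?_, ?_, ?_, i, h1, h2, ?_⟩
      · intro h; exact c_ne0 i h2 (by simpa using h.symm)
      · intro h; exact c_ne1 i h1 h2 (by simpa using h)
      · intro h
        refine c_ne1 (n - i) (by omega) (by omega) ?_
        rw [← h]; linear_combination c_neg i h2
      · rw [← hc]; ring
  have hfib : ∀ D ∈ P.image f, (P.filter (fun p => f p = D)).card = 2 := by
    intro D hD
    obtain ⟨⟨a, i⟩, hp, rfl⟩ := Finset.mem_image.1 hD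
    simp only [hP, Finset.mem_product, Finset.mem_univ, true_and, Finset.mem_Icc] at hp
    obtain ⟨h1, h2⟩ := hp
    have : P.filter (fun p => f p = f (a, i)) = {(a, i), (a + c i, n - i)} := by
      ext ⟨b, j⟩
      simp only [hP, hf, Finset.mem_filter, Finset.mem_product, Finset.mem_univ, true_and,
        Finset.mem_Icc, Finset.mem_insert, Finset.mem_singleton, Prod.mk.injEq]
      constructor
      · rintro ⟨⟨h3, h4⟩, h⟩
        have hb : b ∈ ({a, a + c i} : Finset (ZMod (m * n + 2))) := by rw [← h]; simp
        have hb' : b + c j ∈ ({a, a + c i} : Finset (ZMod (m * n + 2))) := by rw [← h]; simp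
        simp only [Finset.mem_insert, Finset.mem_singleton] at hb hb'
        have hj := c_ne0 j h4
        rcases hb with rfl | rfl
        · left
          refine ⟨rfl, ?_⟩
          rcases hb' with h' | h'
          · exact absurd (by simpa using h') hj
          · exact c_inj _ _ h4 h2 (by simpa using h')
        · right
          refine ⟨rfl, ?_⟩
          rcases hb' with h' | h'
          · refine c_inj _ _ h4 (by omega) ?_
            linear_combination h' - c_neg i h2
          · exact absurd (by simpa using h') hj
      · rintro (⟨rfl, rfl⟩ | ⟨rfl, rfl⟩)
        · exact ⟨⟨h1, h2⟩, rfl⟩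
        · refine ⟨by omega, ?_⟩
          rw [add_assoc, c_neg i h2, add_zero, Finset.pair_comm]
    rw [this, Finset.card_pair]
    intro h
    exact c_ne0 i h2 (by simpa using (congrArg Prod.fst h).symm)
  have hcard := Finset.card_eq_sum_card_image f P
  rw [Finset.sum_congr rfl hfib, Finset.sum_const, smul_eq_mul] at hcard
  rw [hset, Set.ncard_coe_finset, mul_comm, ← hcard, hP, Finset.card_product, Finset.card_univ,
    ZMod.card, Nat.card_Icc, mul_comm]
  simp
end

section
/- Fix an integer m ≥ 1, let V be a finite type, and let q : V → V → ZMod (m+1) → ℕ be an m-coloured quiver which has no loops (q i i c = 0 for all i and c), is locally monochromatic (for all vertices i, j there is at most one colour c with q i j c > 0), and satisfies the symmetry condition q i j c = q j i (m − c) for all i, j, c. Then for every vertex v, the coloured mutation μ_v q has no loops: (μ_v q) i i c = 0 for all i and c. -/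
/-- Coloured mutation at the vertex `v` of an `m`-coloured quiver encoded by its
arrow-count function `q : V → V → ZMod (m+1) → ℕ` (where `q i j c` is the number of
arrows of colour `c` from `i` to `j`). -/
def colMut (m : ℕ) {V : Type*} [DecidableEq V]
    (q : V → V → ZMod (m + 1) → ℕ) (v : V) : V → V → ZMod (m + 1) → ℕ :=
  fun i j c =>
    if i = v then q i j (c + 1)
    else if j = v then q i j (c - 1)
    else
      ((q i j c : ℤ) - ∑ t ∈ Finset.univ.filter (fun t => t ≠ c), (q i j t : ℤ)
        + ((q i v c : ℤ) - (q i v (c - 1) : ℤ)) * (q v j 0 : ℤ)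
        + (q i v (m : ZMod (m + 1)) : ℤ) * ((q v j c : ℤ) - (q v j (c + 1) : ℤ))).toNat

theorem colMut_no_loops (m : ℕ) (hm : 1 ≤ m) {V : Type*} [Fintype V] [DecidableEq V]
    (q : V → V → ZMod (m + 1) → ℕ)
    (hloops : ∀ i c, q i i c = 0)
    (hmono : ∀ i j c c', 0 < q i j c → 0 < q i j c' → c = c')
    (hsymm : ∀ i j c, q i j c = q j i ((m : ZMod (m + 1)) - c))
    (v : V) :
    ∀ i c, colMut m q v i i c = 0 := by
  intro i c
  have hm1 : (m : ZMod (m + 1)) = -1 := by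
    have h : ((m + 1 : ℕ) : ZMod (m + 1)) = 0 := ZMod.natCast_self (m + 1)
    push_cast at h
    exact eq_neg_of_add_eq_zero_left h
  unfold colMut
  by_cases hi : i = v
  · simp [hi, hloops]
  · simp only [hi, if_false, hloops]
    rw [hsymm v i 0, hsymm v i c, hsymm v i (c + 1), hm1, sub_zero]
    by_cases h0 : q i v (-1) = 0
    · simp [h0]
    · have hz : ∀ t, t ≠ -1 → q i v t = 0 := by
        intro t ht
        by_contra h
        exact ht (hmono i v t (-1) (Nat.pos_of_ne_zero h) (Nat.pos_of_ne_zero h0))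
      have key : ∀ s t : ZMod (m + 1), s + t = -2 → q i v s = q i v t := by
        intro s t hst
        by_cases hs : s = -1
        · have : t = -1 := by
            rw [hs] at hst
            linear_combination hst
          rw [hs, this]
        · have ht : t ≠ -1 := by
            intro ht
            apply hs
            rw [ht] at hst
            linear_combination hst
          rw [hz s hs, hz t ht]
      rw [key c (-1 - (c + 1)) (by ring), key (c - 1) (-1 - c) (by ring)]
      simp only [Int.toNat_eq_zero, Nat.cast_zero, Finset.sum_const_zero]
      apply le_of_eq
      ring
end

section
/- Let m = 1, let V be a finite type, and let q : V → V → ZMod 2 → ℕ be a 1-coloured quiver which has no loops (q i i c = 0 for all i and c), is locally monochromatic (for all vertices i, j there is at most one colour c with q i j c > 0), and satisfies the symmetry condition q i j c = q j i (1 − c) for all i, j, c. Then for every vertex v, the colour-0 component of the coloured mutation of q at v coincides with the Fomin–Zelevinsky mutation of the colour-0 component of q: for all i, j, (μ_v q) i j 0 = (μ_v q₀) i j, where q₀ i j = q i j 0. -/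
theorem colMut_one_eq_fzMut {V : Type*} [Fintype V] [DecidableEq V]
    (q : V → V → ZMod 2 → ℕ)
    (hloops : ∀ i c, q i i c = 0)
    (hmono : ∀ i j c c', 0 < q i j c → 0 < q i j c' → c = c')
    (hsymm : ∀ i j c, q i j c = q j i (1 - c))
    (v : V) :
    ∀ i j, colMut 1 q v i j 0 = fzMut (fun i j => q i j 0) v i j := by
  intro i j
  have e1 : ∀ a b, q a b 1 = q b a 0 := fun a b => by
    rw [hsymm a b 1, sub_self]
  have h1 : (0 + 1 : ZMod (1 + 1)) = (1 : ZMod 2) := by decide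
  have h2 : (0 - 1 : ZMod (1 + 1)) = (1 : ZMod 2) := by decide
  have h3 : ((1 : ℕ) : ZMod (1 + 1)) = (1 : ZMod 2) := by decide
  have h4 : (Finset.univ.filter (fun t : ZMod (1 + 1) => t ≠ 0)) = {(1 : ZMod 2)} := by decide
  have h0 : (0 : ZMod (1 + 1)) = (0 : ZMod 2) := rfl
  unfold colMut fzMut
  by_cases hi : i = v
  · rw [if_pos hi, if_pos (Or.inl hi), h1, e1]
  · by_cases hj : j = v
    · rw [if_neg hi, if_pos hj, if_pos (Or.inr hj), h2, e1]
    · rw [if_neg hi, if_neg hj, if_neg (by tauto), h1, h2, h3, h4, Finset.sum_singleton,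
        e1, e1, e1, h0]
      congr 1
      ring
end
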